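/- Let α, β > −1, N ≥ 1 and j ≥ 0. For all θ, φ ∈ (0,π) with θ ≠ φ, the integral (1/Γ(N)) ∫₀^∞ ∂_θ^j H̃_t(θ,φ) t^{N−1} dt converges absolutely and ∂_θ^j K̃_{N/2}(θ,φ) = (1/Γ(N)) ∫₀^∞ ∂_θ^j H̃_t(θ,φ) t^{N−1} dt; that is, differentiation in θ may be interchanged with the integral defining the compensated potential kernel. -/

import Mathlib

open MeasureTheory Real Set Filter
open scoped Classical

noncomputable section

/-- The Jacobi measure dμ_{α,β} on (0,π). -/
def jacobiMeasure (α β : ℝ) : Measure ℝ :=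
  (volume.restrict (Set.Ioo 0 π)).withDensity
    (fun θ => ENNReal.ofReal ((Real.sin (θ/2)) ^ (2*α+1) * (Real.cos (θ/2)) ^ (2*β+1)))

/-- The classical Jacobi polynomial `P_n^{(α,β)}`. -/
def jacobiPoly (α β : ℝ) (n : ℕ) (x : ℝ) : ℝ :=
  ∑ k ∈ Finset.range (n+1),
    (Real.Gamma ((n:ℝ)+α+1) / (Real.Gamma (α+(k:ℝ)+1) * (Nat.factorial (n-k)))) *
    (Real.Gamma ((n:ℝ)+β+1) / (Real.Gamma ((n:ℝ)+β-(k:ℝ)+1) * (Nat.factorial k))) *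
    ((x-1)/2)^k * ((x+1)/2)^(n-k)

/-- Normalized trigonometric Jacobi polynomial `𝒫_n(θ) = c_n P_n^{(α,β)}(cos θ)`. -/
def nJacobi (α β : ℝ) (c : ℕ → ℝ) (n : ℕ) (θ : ℝ) : ℝ :=
  c n * jacobiPoly α β n (Real.cos θ)

def jacobiTau (α β : ℝ) : ℝ := (α + β + 1) / 2

/-- `c` is an admissible sequence of (positive) normalizing constants. -/
def JacobiNormalized (α β : ℝ) (c : ℕ → ℝ) : Prop :=
  (∀ n, 0 < c n) ∧
  ∀ n, ∫ θ, (nJacobi α β c n θ)^2 ∂(jacobiMeasure α β) = 1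

/-- The Jacobi-Poisson kernel. -/
def poissonKer (α β : ℝ) (c : ℕ → ℝ) (t θ φ : ℝ) : ℝ :=
  ∑' n : ℕ, Real.exp (-t * |(n:ℝ) + jacobiTau α β|) * nJacobi α β c n θ * nJacobi α β c n φ

/-- The Riesz-Jacobi kernel of order `N`. -/
def rieszKer (α β : ℝ) (c : ℕ → ℝ) (N : ℕ) (θ φ : ℝ) : ℝ :=
  (1 / Real.Gamma (N:ℝ)) *
    ∫ t in Set.Ioi (0:ℝ), iteratedDeriv N (fun θ' => poissonKer α β c t θ' φ) θ * t ^ (N-1)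

/-- Inner product in `L²(dμ_{α,β})`. -/
def jacobiInner (α β : ℝ) (f g : ℝ → ℝ) : ℝ := ∫ θ, f θ * g θ ∂(jacobiMeasure α β)

/-- The Riesz-Jacobi transform of order `N` on test functions. -/
def rieszTransform (α β : ℝ) (c : ℕ → ℝ) (N : ℕ) (f : ℝ → ℝ) (θ : ℝ) : ℝ :=
  ∑' n : ℕ, |((n:ℝ)+1) + jacobiTau α β| ^ (-(N:ℝ)) *
    jacobiInner α β f (nJacobi α β c (n+1)) *
    iteratedDeriv N (nJacobi α β c (n+1)) θ

/-- `f ∈ C_c^∞(0,π)`. -/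
def IsCcSmooth (f : ℝ → ℝ) : Prop :=
  ContDiff ℝ (⊤ : ℕ∞) f ∧ HasCompactSupport f ∧ tsupport f ⊆ Set.Ioo 0 π

/-- The compensated Jacobi-Poisson kernel
`H̃_t(θ,φ) = H_t(θ,φ) − exp(−t|τ|) 𝒫₀(θ) 𝒫₀(φ)`. -/
def tildePoissonKer (α β : ℝ) (c : ℕ → ℝ) (t θ φ : ℝ) : ℝ :=
  poissonKer α β c t θ φ -
    Real.exp (-t * |jacobiTau α β|) * nJacobi α β c 0 θ * nJacobi α β c 0 φ

/-- The compensated potential kernel `K̃_{N/2}(θ,φ)` (for `σ = N/2`, so that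
`Γ(2σ) = Γ(N)` and `t^{2σ−1} = t^{N−1}`). -/
def tildePotentialKer (α β : ℝ) (c : ℕ → ℝ) (N : ℕ) (θ φ : ℝ) : ℝ :=
  (1 / Real.Gamma (N:ℝ)) *
    ∫ t in Set.Ioi (0:ℝ), tildePoissonKer α β c t θ φ * t ^ (N-1)

section part1

/-- Weight `1 + |n|`. -/
def jkWt (n : ℤ) : ℝ := 1 + |(n : ℝ)|

/-- Discrete symbols of order `m`, controlled up to `K` differences, uniformly in `ι`. -/
def SymbK {ι : Type} : ℕ → ℤ → (ι → ℤ → ℝ) → Prop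
  | 0, m, g => ∃ C : ℝ, ∀ i n, |g i n| ≤ C * jkWt n ^ m
  | K + 1, m, g => (∃ C : ℝ, ∀ i n, |g i n| ≤ C * jkWt n ^ m) ∧
      SymbK K (m - 1) (fun i n => g i (n + 1) - g i n)

lemma jkWt_ge_one (n : ℤ) : 1 ≤ jkWt n := by
  unfold jkWt; linarith [abs_nonneg (n : ℝ)]

lemma jkWt_pos (n : ℤ) : 0 < jkWt n := lt_of_lt_of_le one_pos (jkWt_ge_one n)

lemma jkWt_add_le (n a : ℤ) : jkWt (n + a) ≤ jkWt a * jkWt n := by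
  unfold jkWt; push_cast
  nlinarith [abs_nonneg (n : ℝ), abs_nonneg (a : ℝ), abs_add_le (n : ℝ) (a : ℝ),
    mul_nonneg (abs_nonneg (n : ℝ)) (abs_nonneg (a : ℝ))]

lemma jkWt_neg (a : ℤ) : jkWt (-a) = jkWt a := by
  unfold jkWt; simp

lemma jkWt_le_add (n a : ℤ) : jkWt n ≤ jkWt a * jkWt (n + a) := by
  have := jkWt_add_le (n + a) (-a)
  simpa [jkWt_neg] using this

lemma jkWt_zpow_shift (a m : ℤ) (n : ℤ) :
    jkWt (n + a) ^ m ≤ jkWt a ^ (m.natAbs) * jkWt n ^ m := by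
  rcases le_total 0 m with h | h
  · obtain ⟨k, rfl⟩ := Int.eq_ofNat_of_zero_le h
    simp only [zpow_natCast, Int.natAbs_natCast]
    rw [← mul_pow]
    exact pow_le_pow_left₀ (jkWt_pos _).le (jkWt_add_le n a) k
  · obtain ⟨k, hk⟩ := Int.eq_ofNat_of_zero_le (neg_nonneg.mpr h)
    obtain rfl : m = -(k : ℤ) := by omega
    simp only [zpow_neg, zpow_natCast, Int.natAbs_neg, Int.natAbs_natCast]
    rw [inv_le_iff_one_le_mul₀ (pow_pos (jkWt_pos _) _), mul_assoc,
      mul_comm, mul_assoc, ← mul_pow,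
      inv_mul_eq_div, le_div_iff₀ (pow_pos (jkWt_pos _) _), one_mul]
    refine pow_le_pow_left₀ (jkWt_pos _).le ?_ k
    rw [mul_comm]; exact jkWt_le_add n a

lemma jkWt_zpow_mono {m m' : ℤ} (h : m ≤ m') (n : ℤ) : jkWt n ^ m ≤ jkWt n ^ m' :=
  zpow_le_zpow_right₀ (jkWt_ge_one n) h

section symb
variable {ι : Type}

lemma SymbK.bound {K : ℕ} {m : ℤ} {g : ι → ℤ → ℝ} (h : SymbK K m g) :
    ∃ C : ℝ, 0 ≤ C ∧ ∀ i n, |g i n| ≤ C * jkWt n ^ m := by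
  have : ∃ C : ℝ, ∀ i n, |g i n| ≤ C * jkWt n ^ m := by
    cases K with
    | zero => exact h
    | succ K => exact h.1
  obtain ⟨C, hC⟩ := this
  refine ⟨max C 0, le_max_right _ _, fun i n => (hC i n).trans ?_⟩
  exact mul_le_mul_of_nonneg_right (le_max_left _ _) (zpow_nonneg (jkWt_pos n).le _)

lemma SymbK.pred {K : ℕ} : ∀ {m : ℤ} {g : ι → ℤ → ℝ}, SymbK (K + 1) m g → SymbK K m g := by
  induction K with
  | zero => intro m g h; exact h.1
  | succ K ih => intro m g h; exact ⟨h.1, ih h.2⟩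

lemma SymbK.mono {K : ℕ} : ∀ {m m' : ℤ} {g : ι → ℤ → ℝ}, m ≤ m' → SymbK K m g → SymbK K m' g := by
  have key : ∀ {m m' : ℤ} {g : ι → ℤ → ℝ}, m ≤ m' →
      (∃ C : ℝ, 0 ≤ C ∧ ∀ i n, |g i n| ≤ C * jkWt n ^ m) →
      ∃ C : ℝ, ∀ i n, |g i n| ≤ C * jkWt n ^ m' := by
    rintro m m' g h ⟨C, hC0, hC⟩
    exact ⟨C, fun i n => (hC i n).trans (mul_le_mul_of_nonneg_left (jkWt_zpow_mono h n) hC0)⟩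
  induction K with
  | zero => intro m m' g h hg; exact key h hg.bound
  | succ K ih => intro m m' g h hg; exact ⟨key h hg.bound, ih (by omega) hg.2⟩

lemma SymbK.add {K : ℕ} : ∀ {m : ℤ} {f g : ι → ℤ → ℝ}, SymbK K m f → SymbK K m g →
    SymbK K m (fun i n => f i n + g i n) := by
  have key : ∀ {m : ℤ} {f g : ι → ℤ → ℝ},
      (∃ C : ℝ, 0 ≤ C ∧ ∀ i n, |f i n| ≤ C * jkWt n ^ m) →
      (∃ C : ℝ, 0 ≤ C ∧ ∀ i n, |g i n| ≤ C * jkWt n ^ m) →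
      ∃ C : ℝ, ∀ i n, |f i n + g i n| ≤ C * jkWt n ^ m := by
    rintro m f g ⟨C, -, hC⟩ ⟨D, -, hD⟩
    exact ⟨C + D, fun i n => (abs_add_le _ _).trans (by linarith [hC i n, hD i n])⟩
  induction K with
  | zero => intro m f g hf hg; exact key hf.bound hg.bound
  | succ K ih =>
    intro m f g hf hg
    refine ⟨key hf.bound hg.bound, ?_⟩
    have := ih hf.2 hg.2
    convert this using 3
    ring

lemma SymbK.shift {K : ℕ} (a : ℤ) : ∀ {m : ℤ} {g : ι → ℤ → ℝ}, SymbK K m g →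
    SymbK K m (fun i n => g i (n + a)) := by
  have key : ∀ {m : ℤ} {g : ι → ℤ → ℝ},
      (∃ C : ℝ, 0 ≤ C ∧ ∀ i n, |g i n| ≤ C * jkWt n ^ m) →
      ∃ C : ℝ, ∀ i n, |g i (n + a)| ≤ C * jkWt n ^ m := by
    rintro m g ⟨C, hC0, hC⟩
    refine ⟨C * jkWt a ^ m.natAbs, fun i n => (hC i (n + a)).trans ?_⟩
    rw [mul_assoc]
    exact mul_le_mul_of_nonneg_left (jkWt_zpow_shift a m n) hC0
  induction K with
  | zero => intro m g hg; exact key hg.bound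
  | succ K ih =>
    intro m g hg
    refine ⟨key hg.bound, ?_⟩
    have := ih hg.2
    convert this using 5
    ring

lemma SymbK.mul {K : ℕ} : ∀ {m m' : ℤ} {f g : ι → ℤ → ℝ}, SymbK K m f → SymbK K m' g →
    SymbK K (m + m') (fun i n => f i n * g i n) := by
  have key : ∀ {m m' : ℤ} {f g : ι → ℤ → ℝ},
      (∃ C : ℝ, 0 ≤ C ∧ ∀ i n, |f i n| ≤ C * jkWt n ^ m) →
      (∃ C : ℝ, 0 ≤ C ∧ ∀ i n, |g i n| ≤ C * jkWt n ^ m') →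
      ∃ C : ℝ, ∀ i n, |f i n * g i n| ≤ C * jkWt n ^ (m + m') := by
    rintro m m' f g ⟨C, hC0, hC⟩ ⟨D, -, hD⟩
    refine ⟨C * D, fun i n => ?_⟩
    rw [abs_mul, zpow_add₀ (jkWt_pos n).ne']
    calc |f i n| * |g i n| ≤ (C * jkWt n ^ m) * (D * jkWt n ^ m') :=
          mul_le_mul (hC i n) (hD i n) (abs_nonneg _)
            (mul_nonneg hC0 (zpow_nonneg (jkWt_pos n).le _))
      _ = _ := by ring
  induction K with
  | zero => intro m m' f g hf hg; exact key hf.bound hg.bound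
  | succ K ih =>
    intro m m' f g hf hg
    refine ⟨key hf.bound hg.bound, ?_⟩
    have h1 := ih hf.2 (hg.pred.shift 1)
    have h2 := ih hf.pred hg.2
    rw [show m - 1 + m' = m + m' - 1 by ring] at h1
    rw [show m + (m' - 1) = m + m' - 1 by ring] at h2
    convert h1.add h2 using 3
    ring

/-- Symbols of order `m`. -/
def Symb (m : ℤ) (g : ι → ℤ → ℝ) : Prop := ∀ K, SymbK K m g

lemma Symb.mono {m m' : ℤ} {g : ι → ℤ → ℝ} (h : m ≤ m') (hg : Symb m g) : Symb m' g :=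
  fun K => (hg K).mono h

lemma Symb.add {m : ℤ} {f g : ι → ℤ → ℝ} (hf : Symb m f) (hg : Symb m g) :
    Symb m (fun i n => f i n + g i n) := fun K => (hf K).add (hg K)

lemma Symb.mul {m m' : ℤ} {f g : ι → ℤ → ℝ} (hf : Symb m f) (hg : Symb m' g) :
    Symb (m + m') (fun i n => f i n * g i n) := fun K => (hf K).mul (hg K)

lemma Symb.shift (a : ℤ) {m : ℤ} {g : ι → ℤ → ℝ} (hg : Symb m g) :
    Symb m (fun i n => g i (n + a)) := fun K => (hg K).shift a

lemma Symb.diff {m : ℤ} {g : ι → ℤ → ℝ} (hg : Symb m g) :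
    Symb (m - 1) (fun i n => g i (n + 1) - g i n) := fun K => (hg (K + 1)).2

lemma symbK_zero (K : ℕ) : ∀ (m : ℤ), SymbK K m (fun (_ : ι) _ => (0 : ℝ)) := by
  induction K with
  | zero => intro m; exact ⟨0, by simp⟩
  | succ K ih =>
    intro m
    refine ⟨⟨0, by simp⟩, ?_⟩
    simpa using ih (m - 1)

lemma symb_const (a : ℝ) : Symb 0 (fun (_ : ι) _ => a) := by
  intro K
  cases K with
  | zero => exact ⟨|a|, by simp⟩
  | succ K =>
    refine ⟨⟨|a|, by simp⟩, ?_⟩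
    simpa using symbK_zero K (0 - 1)

lemma Symb.const_mul (a : ℝ) {m : ℤ} {g : ι → ℤ → ℝ} (hg : Symb m g) :
    Symb m (fun i n => a * g i n) := by
  simpa using (symb_const (ι := ι) a).mul hg

lemma Symb.neg {m : ℤ} {g : ι → ℤ → ℝ} (hg : Symb m g) :
    Symb m (fun i n => - g i n) := by
  simpa using hg.const_mul (-1)

lemma Symb.sub {m : ℤ} {f g : ι → ℤ → ℝ} (hf : Symb m f) (hg : Symb m g) :
    Symb m (fun i n => f i n - g i n) := by
  simpa [sub_eq_add_neg] using hf.add hg.neg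

/-- finitely supported (uniformly bounded) families are symbols of every order -/
lemma symb_single (a : ι → ℝ) (C : ℝ) (ha : ∀ i, |a i| ≤ C) (n₀ : ℤ) (m : ℤ) :
    Symb m (fun i n => if n = n₀ then a i else 0) := by
  have key : ∀ (m : ℤ) (n₀ : ℤ), ∃ C : ℝ, ∀ (i : ι) (n : ℤ),
      |if n = n₀ then a i else 0| ≤ C * jkWt n ^ m := by
    intro m n₀
    refine ⟨|C| * (jkWt n₀ ^ m)⁻¹, fun i n => ?_⟩
    split_ifs with h
    · subst h
      rw [mul_assoc, inv_mul_cancel₀ (zpow_pos (jkWt_pos n) _).ne', mul_one]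
      exact (ha i).trans (le_abs_self C)
    · rw [abs_zero]
      exact mul_nonneg (mul_nonneg (abs_nonneg _) (inv_nonneg.mpr (zpow_nonneg (jkWt_pos _).le _)))
        (zpow_nonneg (jkWt_pos _).le _)
  intro K
  have : ∀ (m : ℤ) (n₀ : ℤ), SymbK K m (fun (i : ι) n => if n = n₀ then a i else 0) := by
    clear m n₀
    induction K with
    | zero => intro m n₀; exact key m n₀
    | succ K ih =>
      intro m n₀
      refine ⟨key m n₀, ?_⟩
      have h1 := ih (m - 1) (n₀ - 1)
      have h2 := ih (m - 1) n₀
      have h3 : SymbK K (m - 1) (fun (i : ι) n => (-1 : ℝ) * (if n = n₀ then a i else 0)) := by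
        have := (symb_const (ι := ι) (-1) K).mul h2
        simpa using this
      convert h1.add h3 using 3 with i n
      have : n + 1 = n₀ ↔ n = n₀ - 1 := by omega
      simp only [this]; ring
  exact this m n₀

/-- the identity is a symbol of order one -/
lemma symb_id : Symb 1 (fun (_ : ι) (n : ℤ) => (n : ℝ)) := by
  have key : ∃ C : ℝ, ∀ (i : ι) (n : ℤ), |(n : ℝ)| ≤ C * jkWt n ^ (1 : ℤ) :=
    ⟨1, fun i n => by rw [zpow_one, one_mul]; unfold jkWt; linarith⟩
  intro K
  cases K with
  | zero => exact key
  | succ K =>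
    refine ⟨key, ?_⟩
    have := symb_const (ι := ι) 1 K
    simpa using this

lemma symb_lin (a b : ℝ) : Symb 1 (fun (_ : ι) (n : ℤ) => a * (n : ℝ) + b) :=
  ((symb_id).const_mul a).add ((symb_const b).mono (by norm_num))

/-- cut-off functions are symbols of order zero -/
lemma symb_cut (n₀ : ℤ) : Symb 0 (fun (_ : ι) (n : ℤ) => if n₀ ≤ n then (1 : ℝ) else 0) := by
  have key : ∃ C : ℝ, ∀ (i : ι) (n : ℤ),
      |if n₀ ≤ n then (1 : ℝ) else 0| ≤ C * jkWt n ^ (0 : ℤ) :=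
    ⟨1, fun i n => by split_ifs <;> simp⟩
  intro K
  cases K with
  | zero => exact key
  | succ K =>
    refine ⟨key, ?_⟩
    have := symb_single (ι := ι) (fun _ => 1) 1 (by simp) (n₀ - 1) (0 - 1) K
    convert this using 3 with i n
    beta_reduce
    by_cases h1 : n = n₀ - 1
    · simp [h1]
    · by_cases h2 : n₀ ≤ n
      · rw [if_pos (by omega), if_pos h2, if_neg h1]; ring
      · rw [if_neg (by omega), if_neg h2, if_neg h1]; ring

/-- `1/(n+c)` on `n ≥ n₀` is a symbol of order `-1` -/
lemma symb_inv (c : ℝ) (n₀ : ℤ) (h0 : 0 ≤ n₀) (hc : 0 < (n₀ : ℝ) + c) :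
    Symb (-1) (fun (_ : ι) (n : ℤ) => if n₀ ≤ n then ((n : ℝ) + c)⁻¹ else 0) := by
  have hpos : ∀ n : ℤ, n₀ ≤ n → 0 < (n : ℝ) + c := by
    intro n hn
    have : (n₀ : ℝ) ≤ n := by exact_mod_cast hn
    linarith
  have key : ∃ C : ℝ, ∀ (i : ι) (n : ℤ),
      |if n₀ ≤ n then ((n : ℝ) + c)⁻¹ else 0| ≤ C * jkWt n ^ (-1 : ℤ) := by
    have hC0 : 0 ≤ (1 + |1 - c|) / (n₀ + c) := by positivity
    refine ⟨1 + |1 - c| / (n₀ + c), fun i n => ?_⟩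
    have hw := jkWt_pos n
    split_ifs with h
    · have hn := hpos n h
      rw [abs_of_pos (inv_pos.mpr hn), zpow_neg_one, ← div_eq_mul_inv, le_div_iff₀ hw,
        inv_mul_le_iff₀ hn]
      have hn0 : (0 : ℝ) ≤ n := by exact_mod_cast h0.trans h
      have h1 : (n₀ : ℝ) ≤ n := by exact_mod_cast h
      have h2 : |1 - c| ≤ ((n : ℝ) + c) * (|1 - c| / (n₀ + c)) := by
        rw [mul_div_assoc', le_div_iff₀ hc]
        nlinarith [abs_nonneg (1 - c)]
      unfold jkWt
      rw [abs_of_nonneg hn0]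
      nlinarith [le_abs_self (1 - c)]
    · rw [abs_zero]; positivity
  intro K
  induction K with
  | zero => exact key
  | succ K ih =>
    refine ⟨key, ?_⟩
    have h1 := ih.mul (ih.shift 1)
    have h2 := (symb_const (ι := ι) (-1) K).mul h1
    have h3 := symb_single (ι := ι) (fun _ => ((n₀ : ℝ) + c)⁻¹) _ (fun _ => le_rfl) (n₀ - 1) (-1 - 1) K
    rw [show (0 : ℤ) + (-1 + -1) = -1 - 1 by norm_num] at h2
    convert h2.add h3 using 3 with i n
    beta_reduce
    by_cases h1 : n = n₀ - 1
    · subst h1; simp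
    · by_cases h2 : n₀ ≤ n
      · rw [if_pos (by omega), if_pos h2, if_neg h1]
        have a1 := hpos n h2
        have a2 := hpos (n + 1) (by omega)
        push_cast at a2 ⊢
        field_simp
        ring
      · rw [if_neg (by omega), if_neg h2, if_neg h1]; ring

/-- exponentials -/
lemma symb_exp (t : ι → ℝ) (ht : ∀ i, 0 < t i) (τ : ℝ) (hτ : -1 < τ) (m : ℤ)
    (H : ∀ k : ℕ, ∃ C : ℝ, ∀ i (n : ℤ), 1 ≤ n →
      (1 - exp (-t i)) ^ k * exp (-t i * (n + τ)) ≤ C * jkWt n ^ (m - k)) :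
    Symb m (fun i (n : ℤ) => if 1 ≤ n then exp (-t i * (n + τ)) else 0) := by
  have hle : ∀ i, exp (-t i) ≤ 1 := fun i => by
    rw [Real.exp_le_one_iff]; linarith [ht i]
  have hk : ∀ (k : ℕ), ∃ C : ℝ, ∀ i (n : ℤ),
      |if 1 ≤ n then (1 - exp (-t i)) ^ k * exp (-t i * (n + τ)) else 0| ≤ C * jkWt n ^ (m - k) := by
    intro k
    obtain ⟨C, hC⟩ := H k
    refine ⟨|C|, fun i n => ?_⟩
    split_ifs with h
    · rw [abs_of_nonneg (mul_nonneg (pow_nonneg (by linarith [hle i]) _) (exp_pos _).le)]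
      refine (hC i n h).trans ?_
      exact mul_le_mul_of_nonneg_right (le_abs_self C) (zpow_nonneg (jkWt_pos n).le _)
    · rw [abs_zero]
      exact mul_nonneg (abs_nonneg _) (zpow_nonneg (jkWt_pos n).le _)
  have main : ∀ (K k : ℕ), SymbK K (m - k) (fun i (n : ℤ) =>
      if 1 ≤ n then (1 - exp (-t i)) ^ k * exp (-t i * (n + τ)) else 0) := by
    intro K
    induction K with
    | zero => intro k; exact hk k
    | succ K ih =>
      intro k
      refine ⟨hk k, ?_⟩
      have h1 := (symb_const (ι := ι) (-1) K).mul (ih (k + 1))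
      have h3 := symb_single (ι := ι) (fun i => (1 - exp (-t i)) ^ k * exp (-t i * (1 + τ))) 1
        (fun i => by
          have e1 : exp (-t i * (1 + τ)) ≤ 1 := by
            rw [Real.exp_le_one_iff]; nlinarith [ht i]
          have e2 : (1 - exp (-t i)) ^ k ≤ 1 :=
            pow_le_one₀ (by linarith [hle i]) (by linarith [exp_pos (-t i)])
          have e3 : 0 ≤ (1 - exp (-t i)) ^ k := pow_nonneg (by linarith [hle i]) _
          rw [abs_of_nonneg (mul_nonneg e3 (exp_pos _).le)]
          exact mul_le_one₀ e2 (exp_pos _).le e1) 0 (m - k - 1) K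
      rw [show (0 : ℤ) + (m - ((k + 1 : ℕ) : ℤ)) = m - k - 1 by push_cast; ring] at h1
      convert h1.add h3 using 3 with i n
      beta_reduce
      by_cases h1 : n = 0
      · subst h1; simp
      · by_cases h2 : 1 ≤ n
        · rw [if_pos (by omega), if_pos h2, if_pos h2, if_neg h1]
          push_cast
          rw [show -t i * ((n : ℝ) + 1 + τ) = -t i + -t i * (n + τ) by ring, Real.exp_add]
          ring
        · rw [if_neg (by omega), if_neg h2, if_neg h2, if_neg h1]; ring
  intro K
  simpa using main K 0

end symb
end part1

section part2

section band
variable {ι : Type}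

lemma SymbK.reindex {κ : Type} (r : κ → ι) {K : ℕ} : ∀ {m : ℤ} {g : ι → ℤ → ℝ}, SymbK K m g →
    SymbK K m (fun i n => g (r i) n) := by
  induction K with
  | zero =>
    intro m g h
    obtain ⟨C, -, hC⟩ := h.bound
    exact ⟨C, fun i n => hC (r i) n⟩
  | succ K ih =>
    intro m g h
    obtain ⟨C, -, hC⟩ := h.bound
    exact ⟨⟨C, fun i n => hC (r i) n⟩, ih h.2⟩

lemma Symb.reindex {κ : Type} (r : κ → ι) {m : ℤ} {g : ι → ℤ → ℝ} (h : Symb m g) :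
    Symb m (fun i n => g (r i) n) := fun K => (h K).reindex r

lemma Symb.shift_sub_zero {m : ℤ} {g : ι → ℤ → ℝ} (hg : Symb m g) (p : ℕ) :
    Symb (m - 1) (fun i n => g i (n + p) - g i n) := by
  induction p with
  | zero =>
    have : Symb (m - 1) (fun (_ : ι) (_ : ℤ) => (0 : ℝ)) := fun K => symbK_zero K _
    simpa using this
  | succ p ih =>
    have h2 := hg.diff.shift (p : ℤ)
    convert ih.add h2 using 3 with i n
    push_cast
    rw [show n + ((p : ℤ) + 1) = n + p + 1 by ring]
    ring

lemma Symb.shift_sub {m : ℤ} {g : ι → ℤ → ℝ} (hg : Symb m g) (p q : ℤ) :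
    Symb (m - 1) (fun i n => g i (n + p) - g i (n + q)) := by
  rcases le_total q p with h | h
  · obtain ⟨k, hk⟩ := Int.eq_ofNat_of_zero_le (sub_nonneg.mpr h)
    have := (hg.shift_sub_zero k).shift q
    convert this using 5 with i n
    try simp only [Int.ofNat_eq_natCast] at hk
    rw [← hk]; ring
  · obtain ⟨k, hk⟩ := Int.eq_ofNat_of_zero_le (sub_nonneg.mpr h)
    have := ((hg.shift_sub_zero k).shift p).neg
    convert this using 3 with i n
    try simp only [Int.ofNat_eq_natCast] at hk
    rw [← hk, show n + p + (q - p) = n + q by ring]; ring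

lemma Symb.comm {m : ℤ} {a g : ι → ℤ → ℝ} (ha : Symb 0 a) (hg : Symb m g) (p q r s : ℤ) :
    Symb (m - 1) (fun i n => a i (n + p) * g i (n + q) - a i (n + r) * g i (n + s)) := by
  have h1 := (ha.shift_sub p r).mul (hg.shift q)
  have h2 := (ha.shift r).mul (hg.shift_sub q s)
  rw [show (0 : ℤ) - 1 + m = m - 1 by ring] at h1
  rw [show (0 : ℤ) + (m - 1) = m - 1 by ring] at h2
  convert h1.add h2 using 3 with i n
  ring

/-- Banded arrays whose diagonals are symbols. -/
structure BandSymb (m : ℤ) (F : ι → ℤ → ℤ → ℝ) : Prop where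
  band : ∃ M : ℕ, ∀ i n k, (M : ℤ) < |k - n| → F i n k = 0
  symb : ∀ d : ℤ, Symb m (fun i n => F i n (n + d))

/-- Commutator with a tridiagonal matrix. -/
def adT (A B C : ℤ → ℝ) (F : ℤ → ℤ → ℝ) : ℤ → ℤ → ℝ := fun n k =>
  A (n - 1) * F (n - 1) k + B n * F n k + C (n + 1) * F (n + 1) k
    - C k * F n (k - 1) - B k * F n k - A k * F n (k + 1)

lemma BandSymb.adT {m : ℤ} {F : ι → ℤ → ℤ → ℝ} (hF : BandSymb m F) {A B C : ℤ → ℝ}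
    (hA : Symb 0 (fun (_ : Unit) n => A n)) (hB : Symb 0 (fun (_ : Unit) n => B n))
    (hC : Symb 0 (fun (_ : Unit) n => C n)) :
    BandSymb (m - 1) (fun i => adT A B C (F i)) := by
  constructor
  · obtain ⟨M, hM⟩ := hF.band
    refine ⟨M + 1, fun i n k h => ?_⟩
    push_cast at h
    have h1 : |k - n| ≤ |k - (n - 1)| + 1 := by
      have := abs_add_le (k - (n - 1)) (-1)
      rw [show k - (n - 1) + -1 = k - n by ring] at this
      simpa using this
    have h2 : |k - n| ≤ |k - (n + 1)| + 1 := by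
      have := abs_add_le (k - (n + 1)) 1
      rw [show k - (n + 1) + 1 = k - n by ring] at this
      simpa using this
    have h3 : |k - n| ≤ |k - 1 - n| + 1 := by
      have := abs_add_le (k - 1 - n) 1
      rw [show k - 1 - n + 1 = k - n by ring] at this
      simpa using this
    have h4 : |k - n| ≤ |k + 1 - n| + 1 := by
      have := abs_add_le (k + 1 - n) (-1)
      rw [show k + 1 - n + -1 = k - n by ring] at this
      simpa using this
    unfold _root_.adT
    rw [hM i (n - 1) k (by omega), hM i n k (by omega), hM i (n + 1) k (by omega),
      hM i n (k - 1) (by omega), hM i n (k + 1) (by omega)]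
    ring
  · intro d
    have kA := (hA.reindex (fun _ : ι => ())).comm (hF.symb (d + 1)) (-1) (-1) d 0
    have kB := (hB.reindex (fun _ : ι => ())).comm (hF.symb d) 0 0 d 0
    have kC := (hC.reindex (fun _ : ι => ())).comm (hF.symb (d - 1)) 1 1 d 0
    convert (kA.add kB).add kC using 3 with i n
    unfold _root_.adT
    have e1 : n + -1 + (d + 1) = n + d := by ring
    have e2 : n + 1 + (d - 1) = n + d := by ring
    have e3 : n + (d + 1) = n + d + 1 := by ring
    have e4 : n + (d - 1) = n + d - 1 := by ring
    simp only [add_zero, e1, e2, e3, e4, ← sub_eq_add_neg]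
    have e5 : n - 1 + (d + 1) = n + d := by ring
    try rw [e5]
    ring

lemma BandSymb.decay {p : ℕ} {F : ι → ℤ → ℤ → ℝ} (hF : BandSymb (-(2 * p : ℤ)) F) :
    ∃ C : ℝ, 0 ≤ C ∧ ∀ i n k, |F i n k| * (jkWt n ^ p * jkWt k ^ p) ≤ C := by
  obtain ⟨M, hM⟩ := hF.band
  have := fun d => (hF.symb d 0).bound
  choose C hC0 hC using this
  refine ⟨∑ d ∈ Finset.Icc (-(M : ℤ)) M, C d * jkWt d ^ p,
    Finset.sum_nonneg fun d _ => mul_nonneg (hC0 d) (pow_nonneg (jkWt_pos d).le _), ?_⟩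
  intro i n k
  by_cases h : (M : ℤ) < |k - n|
  · rw [hM i n k h, abs_zero, zero_mul]
    exact Finset.sum_nonneg fun d _ => mul_nonneg (hC0 d) (pow_nonneg (jkWt_pos d).le _)
  · push Not at h
    set d := k - n with hd
    have hk : k = n + d := by omega
    have hmem : d ∈ Finset.Icc (-(M : ℤ)) M := by
      rw [Finset.mem_Icc]; exact abs_le.mp h
    refine le_trans ?_ (Finset.single_le_sum
      (f := fun d => C d * jkWt d ^ p) (fun d _ => mul_nonneg (hC0 d) (pow_nonneg (jkWt_pos d).le _)) hmem)
    have h1 := hC d i n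
    have h2 : jkWt k ^ p ≤ jkWt d ^ p * jkWt n ^ p := by
      rw [← mul_pow, hk]
      exact pow_le_pow_left₀ (jkWt_pos _).le (jkWt_add_le n d) p
    rw [← hk] at h1
    have hw := jkWt_pos n
    have h3 : jkWt n ^ (-(2 * p : ℤ)) * (jkWt n ^ p * jkWt n ^ p) = 1 := by
      rw [← pow_add, ← zpow_natCast, ← zpow_add₀ hw.ne']
      push_cast
      rw [show -(2 * (p : ℤ)) + (p + p) = 0 by ring, zpow_zero]
    calc |F i n k| * (jkWt n ^ p * jkWt k ^ p)
        ≤ (C d * jkWt n ^ (-(2 * p : ℤ))) * (jkWt n ^ p * (jkWt d ^ p * jkWt n ^ p)) := by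
          have hw' := jkWt_pos k
          apply mul_le_mul h1 _ (by positivity)
            (mul_nonneg (hC0 d) (zpow_nonneg hw.le _))
          exact mul_le_mul_of_nonneg_left h2 (by positivity)
      _ = C d * jkWt d ^ p * (jkWt n ^ (-(2 * p : ℤ)) * (jkWt n ^ p * jkWt n ^ p)) := by ring
      _ = C d * jkWt d ^ p := by rw [h3, mul_one]

end band

/-- polynomially bounded sequences -/
def PolyB (u : ℤ → ℝ) : Prop := ∃ (C : ℝ) (q : ℕ), 0 ≤ C ∧ ∀ n, |u n| ≤ C * jkWt n ^ q

lemma PolyB.shift {u : ℤ → ℝ} (h : PolyB u) (a : ℤ) : PolyB (fun n => u (n + a)) := by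
  obtain ⟨C, q, hC0, hC⟩ := h
  refine ⟨C * jkWt a ^ q, q, mul_nonneg hC0 (pow_nonneg (jkWt_pos _).le _), fun n => ?_⟩
  refine (hC (n + a)).trans ?_
  rw [mul_assoc, ← mul_pow]
  exact mul_le_mul_of_nonneg_left (pow_le_pow_left₀ (jkWt_pos _).le (jkWt_add_le n a) q) hC0

lemma PolyB.mul {u v : ℤ → ℝ} (hu : PolyB u) (hv : PolyB v) : PolyB (fun n => u n * v n) := by
  obtain ⟨C, q, hC0, hC⟩ := hu
  obtain ⟨D, r, hD0, hD⟩ := hv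
  refine ⟨C * D, q + r, mul_nonneg hC0 hD0, fun n => ?_⟩
  rw [abs_mul, pow_add]
  calc |u n| * |v n| ≤ (C * jkWt n ^ q) * (D * jkWt n ^ r) :=
        mul_le_mul (hC n) (hD n) (abs_nonneg _) (mul_nonneg hC0 (pow_nonneg (jkWt_pos n).le _))
    _ = _ := by ring

lemma Symb.polyB {a : ℤ → ℝ} (h : Symb 0 (fun (_ : Unit) n => a n)) : PolyB a := by
  obtain ⟨C, hC0, hC⟩ := (h 0).bound
  exact ⟨C, 0, hC0, fun n => by simpa using hC () n⟩

lemma summable_jkWt : Summable (fun n : ℤ => (jkWt n ^ 2)⁻¹) := by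
  have h : Summable (fun n : ℤ => 1 / (n : ℝ) ^ 2) :=
    Real.summable_one_div_int_pow.mpr (by norm_num)
  refine Summable.of_norm_bounded_eventually (g := fun n : ℤ => 1 / (n : ℝ) ^ 2) h ?_
  have : ({0}ᶜ : Set ℤ) ∈ (Filter.cofinite : Filter ℤ) :=
    (Set.finite_singleton (0 : ℤ)).compl_mem_cofinite
  filter_upwards [this] with n hn
  have hn' : (n : ℝ) ≠ 0 := by exact_mod_cast (show n ≠ 0 by simpa using hn)
  have hw := jkWt_pos n
  rw [Real.norm_of_nonneg (by positivity), ← one_div]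
  apply one_div_le_one_div_of_le (by positivity)
  rw [← sq_abs (n : ℝ)]
  exact pow_le_pow_left₀ (abs_nonneg _) (by unfold jkWt; linarith) 2

lemma summable_jkWt2 : Summable (fun x : ℤ × ℤ => (jkWt x.1 ^ 2)⁻¹ * (jkWt x.2 ^ 2)⁻¹) :=
  summable_jkWt.mul_of_nonneg summable_jkWt
    (fun n => inv_nonneg.mpr (pow_nonneg (jkWt_pos n).le _))
    (fun n => inv_nonneg.mpr (pow_nonneg (jkWt_pos n).le _))

lemma term_bound {c C D E : ℝ} {q : ℕ} {n k : ℤ} {u v : ℝ} (hC : 0 ≤ C) (hD : 0 ≤ D)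
    (hF : |c| * (jkWt n ^ (q + 2) * jkWt k ^ (q + 2)) ≤ E)
    (hu : |u| ≤ C * jkWt n ^ q) (hv : |v| ≤ D * jkWt k ^ q) :
    |c * u * v| ≤ (E * C * D) * ((jkWt n ^ 2)⁻¹ * (jkWt k ^ 2)⁻¹) := by
  have hn := jkWt_pos n
  have hk := jkWt_pos k
  rw [abs_mul, abs_mul]
  calc |c| * |u| * |v| ≤ |c| * (C * jkWt n ^ q) * (D * jkWt k ^ q) := by
        apply mul_le_mul _ hv (abs_nonneg _) (by positivity)
        exact mul_le_mul_of_nonneg_left hu (abs_nonneg _)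
    _ = (|c| * (jkWt n ^ (q + 2) * jkWt k ^ (q + 2))) * (C * D) *
          ((jkWt n ^ 2)⁻¹ * (jkWt k ^ 2)⁻¹) := by
        rw [pow_add, pow_add]; field_simp
    _ ≤ E * (C * D) * ((jkWt n ^ 2)⁻¹ * (jkWt k ^ 2)⁻¹) := by
        apply mul_le_mul_of_nonneg_right _ (by positivity)
        exact mul_le_mul_of_nonneg_right hF (by positivity)
    _ = _ := by ring

lemma PolyB.up {C : ℝ} {q r : ℕ} {u : ℝ} {n : ℤ} (hC : 0 ≤ C) (h : |u| ≤ C * jkWt n ^ q) (hr : q ≤ r) :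
    |u| ≤ C * jkWt n ^ r :=
  h.trans (mul_le_mul_of_nonneg_left (pow_le_pow_right₀ (jkWt_ge_one n) hr) hC)

/-- rapidly decaying banded arrays -/
def RapidB (F : ℤ → ℤ → ℝ) : Prop := ∀ m : ℤ, BandSymb m (fun _ : Unit => F)

lemma RapidB.summable {F : ℤ → ℤ → ℝ} (hF : RapidB F) {u v : ℤ → ℝ} (hu : PolyB u) (hv : PolyB v) :
    Summable (fun x : ℤ × ℤ => F x.1 x.2 * u x.1 * v x.2) := by
  obtain ⟨C, q, hC0, hC⟩ := hu
  obtain ⟨D, r, hD0, hD⟩ := hv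
  obtain ⟨E, -, hE⟩ := (hF (-(2 * ((max q r + 2 : ℕ) : ℤ)))).decay
  refine Summable.of_norm_bounded (summable_jkWt2.mul_left (E * C * D)) fun x => ?_
  exact term_bound hC0 hD0 (hE () x.1 x.2) (PolyB.up hC0 (hC _) (le_max_left _ _))
    (PolyB.up hD0 (hD _) (le_max_right _ _))

lemma RapidB.adT {F : ℤ → ℤ → ℝ} (hF : RapidB F) {A B C : ℤ → ℝ}
    (hA : Symb 0 (fun (_ : Unit) n => A n)) (hB : Symb 0 (fun (_ : Unit) n => B n))
    (hC : Symb 0 (fun (_ : Unit) n => C n)) : RapidB (adT A B C F) := by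
  intro m
  have := (hF (m + 1)).adT hA hB hC
  simpa using this

lemma hasSum_shift1 {f : ℤ × ℤ → ℝ} {s : ℝ} (h : HasSum f s) (a b : ℤ) :
    HasSum (fun x : ℤ × ℤ => f (x.1 + a, x.2 + b)) s :=
  (Equiv.prodCongr (Equiv.addRight a) (Equiv.addRight b)).hasSum_iff.mpr h

lemma _root_.HasSum.congr_fun' {f g : ℤ × ℤ → ℝ} {s : ℝ} (h : HasSum f s) (hfg : ∀ z, g z = f z) :
    HasSum g s := by
  rw [show g = f from funext hfg]; exact h

/-- multiplication by `x - y` is the commutator -/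
lemma RapidB.tsum_adT {F : ℤ → ℤ → ℝ} (hF : RapidB F) {A B C : ℤ → ℝ}
    (hA : Symb 0 (fun (_ : Unit) n => A n)) (hB : Symb 0 (fun (_ : Unit) n => B n))
    (hC : Symb 0 (fun (_ : Unit) n => C n)) {u v : ℤ → ℝ} (hu : PolyB u) (hv : PolyB v) {x y : ℝ}
    (hx : ∀ n, x * u n = A n * u (n + 1) + B n * u n + C n * u (n - 1))
    (hy : ∀ n, y * v n = C (n + 1) * v (n + 1) + B n * v n + A (n - 1) * v (n - 1)) :
    ∑' z : ℤ × ℤ, _root_.adT A B C F z.1 z.2 * u z.1 * v z.2 =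
      (x - y) * ∑' z : ℤ × ℤ, F z.1 z.2 * u z.1 * v z.2 := by
  have s1 := hF.summable (hA.polyB.mul (hu.shift 1)) hv
  have s2 := hF.summable (hB.polyB.mul hu) hv
  have s3 := hF.summable (hC.polyB.mul (hu.shift (-1))) hv
  have s4 := hF.summable hu ((hC.polyB.shift 1).mul (hv.shift 1))
  have s5 := hF.summable hu (hB.polyB.mul hv)
  have s6 := hF.summable hu ((hA.polyB.shift (-1)).mul (hv.shift (-1)))
  have s0 := (hF.summable hu hv).hasSum
  have t1 := hasSum_shift1 s1.hasSum (-1) 0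
  have t3 := hasSum_shift1 s3.hasSum 1 0
  have t4 := hasSum_shift1 s4.hasSum 0 (-1)
  have t6 := hasSum_shift1 s6.hasSum 0 1
  have hX := ((s1.hasSum.add s2.hasSum).add s3.hasSum).unique
    ((s0.mul_left x).congr_fun' (fun z => by
      simp only [← sub_eq_add_neg]
      linear_combination (-F z.1 z.2 * v z.2) * hx z.1))
  have hY := ((s4.hasSum.add s5.hasSum).add s6.hasSum).unique
    ((s0.mul_left y).congr_fun' (fun z => by
      simp only [← sub_eq_add_neg]
      linear_combination (-F z.1 z.2 * u z.1) * hy z.2))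
  have hT := ((((t1.add s2.hasSum).add t3).sub t4).sub s5.hasSum).sub t6
  have hT' : HasSum (fun z : ℤ × ℤ => _root_.adT A B C F z.1 z.2 * u z.1 * v z.2) _ :=
    hT.congr_fun' (fun z => by
      unfold _root_.adT
      simp only [add_zero, ← sub_eq_add_neg, sub_add_cancel, add_sub_cancel_right]
      ring)
  rw [hT'.tsum_eq, sub_mul, ← hX, ← hY]
  ring
end part2

section part3

lemma gronwall_poly (Y : ℕ → ℝ) (κ p : ℕ) (D : ℝ) (hD : 0 ≤ D) (hY0 : 0 ≤ Y 0)
    (h : ∀ n : ℕ, Y (n + 1) ≤ (1 + κ / ((n : ℝ) + 1)) * Y n + D * ((n : ℝ) + 2) ^ p) (n : ℕ) :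
    Y n ≤ (Y 0 + D) * ((n : ℝ) + 1) ^ (κ + p + 1) := by
  have main : ∀ n : ℕ, Y n ≤ ((n : ℝ) + 1) ^ κ * (Y 0 + D * n * ((n : ℝ) + 1) ^ p) := by
    intro n
    induction n with
    | zero => simp
    | succ n ih =>
      have hn : (0 : ℝ) < (n : ℝ) + 1 := by positivity
      have h1 : 1 + κ / ((n : ℝ) + 1) ≤ (((n : ℝ) + 2) / (n + 1)) ^ κ := by
        have := one_add_mul_le_pow (a := 1 / ((n : ℝ) + 1))
          (by have : 0 < 1 / ((n : ℝ) + 1) := by positivity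
              linarith) κ
        rw [show 1 + 1 / ((n : ℝ) + 1) = ((n : ℝ) + 2) / (n + 1) by field_simp; ring] at this
        rw [div_eq_mul_one_div]; exact this
      have h2 : (((n : ℝ) + 2) / (n + 1)) ^ κ * (((n : ℝ) + 1) ^ κ) = ((n : ℝ) + 2) ^ κ := by
        rw [← mul_pow, div_mul_cancel₀ _ hn.ne']
      have h3 : ((n : ℝ) + 1) ^ p ≤ ((n : ℝ) + 2) ^ p :=
        pow_le_pow_left₀ hn.le (by linarith) p
      have h4 : (1 : ℝ) ≤ ((n : ℝ) + 2) ^ κ := one_le_pow₀ (by linarith)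
      have h5 : 0 ≤ D * ((n : ℝ) + 2) ^ p := by positivity
      push_cast
      rw [show (n : ℝ) + 1 + 1 = n + 2 by ring]
      calc Y (n + 1) ≤ (1 + κ / ((n : ℝ) + 1)) * Y n + D * ((n : ℝ) + 2) ^ p := h n
        _ ≤ (1 + κ / ((n : ℝ) + 1)) * (((n : ℝ) + 1) ^ κ * (Y 0 + D * n * ((n : ℝ) + 1) ^ p))
              + D * ((n : ℝ) + 2) ^ p := by
            have : 0 ≤ 1 + κ / ((n : ℝ) + 1) := by positivity
            nlinarith [mul_le_mul_of_nonneg_left ih this]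
        _ ≤ (((n : ℝ) + 2) / (n + 1)) ^ κ * (((n : ℝ) + 1) ^ κ * (Y 0 + D * n * ((n : ℝ) + 1) ^ p))
              + D * ((n : ℝ) + 2) ^ p := by
            have : 0 ≤ (((n : ℝ) + 1) ^ κ * (Y 0 + D * n * ((n : ℝ) + 1) ^ p)) := by positivity
            nlinarith [mul_le_mul_of_nonneg_right h1 this]
        _ = ((n : ℝ) + 2) ^ κ * (Y 0 + D * n * ((n : ℝ) + 1) ^ p) + D * ((n : ℝ) + 2) ^ p := by
            rw [← mul_assoc, h2]
        _ ≤ ((n : ℝ) + 2) ^ κ * (Y 0 + D * n * ((n : ℝ) + 2) ^ p)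
              + ((n : ℝ) + 2) ^ κ * (D * ((n : ℝ) + 2) ^ p) := by
            refine add_le_add ?_ (le_mul_of_one_le_left h5 h4)
            gcongr
        _ = _ := by ring
  refine (main n).trans ?_
  have h1 : (1 : ℝ) ≤ (n : ℝ) + 1 := by linarith [(Nat.cast_nonneg n : (0 : ℝ) ≤ n)]
  rw [show (Y 0 + D) * ((n : ℝ) + 1) ^ (κ + p + 1)
    = ((n : ℝ) + 1) ^ κ * ((Y 0 + D) * (((n : ℝ) + 1) ^ p * (n + 1))) by ring]
  refine mul_le_mul_of_nonneg_left ?_ (by positivity)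
  have h2 : Y 0 ≤ Y 0 * (((n : ℝ) + 1) ^ p * (n + 1)) :=
    le_mul_of_one_le_right hY0 (one_le_mul_of_one_le_of_one_le (one_le_pow₀ h1) h1)
  have h3 : D * n * ((n : ℝ) + 1) ^ p ≤ D * (((n : ℝ) + 1) ^ p * (n + 1)) := by
    have : 0 ≤ D * ((n : ℝ) + 1) ^ p := by positivity
    nlinarith
  linarith

lemma growth_rec (K D Z : ℝ) (p : ℕ) (hK : 0 ≤ K) (hD : 0 ≤ D) (hZ : 0 ≤ Z) :
    ∃ (C : ℝ) (q : ℕ), 0 ≤ C ∧ ∀ (θ : ℝ) (z r : ℕ → ℝ), |z 0| ≤ Z → |z 1| ≤ Z →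
      (∀ n, z (n + 2) = 2 * cos θ * z (n + 1) - z n + r n) →
      (∀ n : ℕ, |r n| ≤ K / ((n : ℝ) + 2) ^ 2 * (|z (n + 1)| + |z n|) + D * ((n : ℝ) + 2) ^ p) →
      ∀ n : ℕ, |z n| ≤ C * ((n : ℝ) + 1) ^ q := by
  obtain ⟨κ, hκ⟩ := exists_nat_ge (2 * K)
  let Y : ℕ → ℝ := fun n => Nat.rec (2 * Z)
    (fun n y => (1 + κ / ((n : ℝ) + 1)) * y + D * ((n : ℝ) + 2) ^ p) n
  have hY0 : Y 0 = 2 * Z := rfl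
  have hYs : ∀ n : ℕ, Y (n + 1) = (1 + κ / ((n : ℝ) + 1)) * Y n + D * ((n : ℝ) + 2) ^ p :=
    fun n => rfl
  have hYnn : ∀ n, 0 ≤ Y n := by
    intro n
    induction n with
    | zero => rw [hY0]; positivity
    | succ n ih => rw [hYs]; positivity
  have hYm : ∀ n, Y n ≤ Y (n + 1) := by
    intro n
    rw [hYs]
    have h1 : 0 ≤ κ / ((n : ℝ) + 1) * Y n := mul_nonneg (by positivity) (hYnn n)
    have h2 : 0 ≤ D * ((n : ℝ) + 2) ^ p := by positivity
    linarith
  refine ⟨2 * Z + D, κ + p + 1 + 1, by positivity, ?_⟩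
  intro θ z r h0 h1 hz hr
  let w : ℂ := Complex.exp (θ * Complex.I)
  let w' : ℂ := Complex.exp (-θ * Complex.I)
  have hw : ‖w‖ = 1 := by
    simpa [w] using Complex.norm_exp_ofReal_mul_I θ
  have hw' : ‖w'‖ = 1 := by
    have := Complex.norm_exp_ofReal_mul_I (-θ)
    simpa [w'] using this
  have hww : w * w' = 1 := by
    simp only [w, w']; rw [← Complex.exp_add]; simp
  have hsum : w + w' = 2 * cos θ := by
    simp only [w, w']; rw [Complex.ofReal_cos, Complex.cos]; ring
  let e : ℕ → ℂ := fun n => z (n + 1) - w * z n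
  have he : ∀ n, e (n + 1) = w' * e n + r n := by
    intro n
    simp only [e]
    rw [hz n]
    push_cast
    rw [Complex.ofReal_cos] at hsum
    linear_combination (-(z (n + 1) : ℂ)) * hsum + (z n : ℂ) * hww
  have main : ∀ n, ‖e n‖ ≤ Y n ∧ |z n| ≤ ((n : ℝ) + 1) * Y n := by
    intro n
    induction n with
    | zero =>
      constructor
      · rw [hY0]
        calc ‖e 0‖ ≤ ‖(z 1 : ℂ)‖ + ‖w * z 0‖ := norm_sub_le _ _
          _ = |z 1| + |z 0| := by rw [norm_mul, hw, one_mul, Complex.norm_real, Complex.norm_real]; rfl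
          _ ≤ 2 * Z := by linarith
      · rw [hY0]; push_cast; linarith
    | succ n ih =>
      obtain ⟨i1, i2⟩ := ih
      have hz1 : |z (n + 1)| ≤ ((n : ℝ) + 2) * Y n := by
        have : (z (n + 1) : ℂ) = e n + w * z n := by simp only [e]; ring
        have h2 : ‖(z (n + 1) : ℂ)‖ ≤ ‖e n‖ + ‖w * z n‖ := by rw [this]; exact norm_add_le _ _
        rw [norm_mul, hw, one_mul, Complex.norm_real, Complex.norm_real] at h2
        simp only [Real.norm_eq_abs] at h2
        linarith
      constructor
      · have h2 : ‖e (n + 1)‖ ≤ ‖e n‖ + |r n| := by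
          rw [he]
          refine (norm_add_le _ _).trans ?_
          rw [norm_mul, hw', one_mul, Complex.norm_real]; rfl
        have h3 := hr n
        have hn2 : (0 : ℝ) < (n : ℝ) + 2 := by positivity
        have h4 : K / ((n : ℝ) + 2) ^ 2 * (|z (n + 1)| + |z n|) ≤ κ / ((n : ℝ) + 1) * Y n := by
          calc K / ((n : ℝ) + 2) ^ 2 * (|z (n + 1)| + |z n|)
              ≤ K / ((n : ℝ) + 2) ^ 2 * (2 * ((n + 2) * Y n)) := by
                apply mul_le_mul_of_nonneg_left _ (by positivity)
                have := hYnn n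
                nlinarith
            _ = (2 * K) / ((n : ℝ) + 2) * Y n := by field_simp
            _ ≤ κ / ((n : ℝ) + 1) * Y n := by
                apply mul_le_mul_of_nonneg_right _ (hYnn n)
                exact div_le_div₀ (by positivity) hκ (by positivity) (by linarith)
        rw [hYs]
        linarith
      · push_cast
        have := hYm n
        have := mul_le_mul_of_nonneg_left this (show (0 : ℝ) ≤ (n : ℝ) + 2 by positivity)
        linarith
  intro n
  have hg := gronwall_poly Y κ p D hD (hYnn 0) (fun n => (hYs n).le) n
  rw [hY0] at hg
  calc |z n| ≤ ((n : ℝ) + 1) * Y n := (main n).2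
    _ ≤ ((n : ℝ) + 1) * ((2 * Z + D) * ((n : ℝ) + 1) ^ (κ + p + 1)) :=
        mul_le_mul_of_nonneg_left hg (by positivity)
    _ = _ := by ring
end part3

section part4

/-- Abstract three-term recurrence system. -/
structure JSys (u : ℤ → ℝ → ℝ) (b γ W : ℤ → ℝ) : Prop where
  smooth : ∀ n, ContDiff ℝ (⊤ : ℕ∞) (u n)
  uneg : ∀ n, n < 0 → ∀ θ, u n θ = 0
  uzero : ∀ θ, u 0 θ = 1
  hrec : ∀ n, 0 ≤ n → ∀ θ, 2 * cos θ * u n θ = u (n + 1) θ + b n * u n θ + γ n * u (n - 1) θ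
  hb : Symb (-2) (fun (_ : Unit) n => b n)
  hγ : Symb (-2) (fun (_ : Unit) n => γ n - if 1 ≤ n then 1 else 0)
  bneg : ∀ n, n < 0 → b n = 0
  γneg : ∀ n, n ≤ 0 → γ n = 0
  γpos : ∀ n, 1 ≤ n → 0 < γ n
  Wneg : ∀ n, n < 0 → W n = 0
  Wrec : ∀ n, 0 ≤ n → γ (n + 1) * W (n + 1) = W n
  W0 : 0 ≤ W 0

lemma abs_iteratedDeriv_two_cos (i : ℕ) (θ : ℝ) :
    |iteratedDeriv i (fun x => 2 * cos x) θ| ≤ 2 := by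
  have : iteratedDeriv i (fun x => 2 * cos x) θ = 2 * iteratedDeriv i cos θ := by
    rw [iteratedDeriv_const_mul_field]
  rw [this, abs_mul]
  have h := Real.abs_iteratedDeriv_cos_le_one i θ
  simp only [abs_two]; linarith

variable {u : ℤ → ℝ → ℝ} {b γ W : ℤ → ℝ}

lemma jkWt_natCast (n : ℕ) : jkWt (n : ℤ) = (n : ℝ) + 1 := by
  unfold jkWt; simp; ring

lemma JSys.u1 (h : JSys u b γ W) (θ : ℝ) : u 1 θ = 2 * cos θ - b 0 := by
  have := h.hrec 0 le_rfl θ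
  rw [h.uzero, h.γneg 0 le_rfl] at this
  simp at this; linarith

lemma JSys.smoothAt (h : JSys u b γ W) (n : ℤ) (j : ℕ) (θ : ℝ) : ContDiffAt ℝ j (u n) θ :=
  ((h.smooth n).of_le (by exact_mod_cast le_top)).contDiffAt

lemma iteratedDeriv_const_bound (j : ℕ) (a θ : ℝ) : |iteratedDeriv j (fun _ : ℝ => a) θ| ≤ |a| := by
  rw [iteratedDeriv_const]
  split_ifs <;> simp

lemma two_cos_smoothAt (j : ℕ) (θ : ℝ) : ContDiffAt ℝ j (fun x : ℝ => 2 * cos x) θ :=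
  (contDiff_const.mul Real.contDiff_cos).contDiffAt

lemma JSys.growth (h : JSys u b γ W) (j : ℕ) : ∃ (C : ℝ) (q : ℕ), 0 ≤ C ∧ ∀ i < j, ∀ (n : ℕ) (θ : ℝ),
    |iteratedDeriv i (u n) θ| ≤ C * ((n : ℝ) + 1) ^ q := by
  induction j with
  | zero => exact ⟨0, 0, le_rfl, fun i hi => by omega⟩
  | succ j ih =>
    obtain ⟨C, q, hC, hb⟩ := ih
    obtain ⟨Kb, hKb0, hKb⟩ := (h.hb 0).bound
    obtain ⟨Kg, hKg0, hKg⟩ := (h.hγ 0).bound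
    have hD : 0 ≤ ∑ i ∈ Finset.range j, ((j.choose (i + 1) : ℕ) : ℝ) * 2 * C :=
      Finset.sum_nonneg fun i _ => by positivity
    obtain ⟨C', q', hC', hg⟩ := growth_rec (Kb + Kg)
      (∑ i ∈ Finset.range j, ((j.choose (i + 1) : ℕ) : ℝ) * 2 * C) (2 + |b 0|) q
      (by positivity) hD (by positivity)
    have new : ∀ (n : ℕ) (θ : ℝ), |iteratedDeriv j (u n) θ| ≤ C' * ((n : ℝ) + 1) ^ q' := by
      intro n θ
      refine hg θ (fun n => iteratedDeriv j (u n) θ)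
        (fun n => (∑ i ∈ Finset.range j, ((j.choose (i + 1) : ℕ) : ℝ) *
            iteratedDeriv (i + 1) (fun x => 2 * cos x) θ * iteratedDeriv (j - (i + 1)) (u ((n + 1 : ℕ) : ℤ)) θ)
          - b (n + 1) * iteratedDeriv j (u ((n + 1 : ℕ) : ℤ)) θ
          - (γ (n + 1) - 1) * iteratedDeriv j (u n) θ) ?_ ?_ ?_ ?_ n
      · have : u ((0 : ℕ) : ℤ) = fun _ => (1 : ℝ) := by
          funext x; exact h.uzero x
        simp only [this]
        refine (iteratedDeriv_const_bound j 1 θ).trans ?_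
        simp; linarith [abs_nonneg (b 0)]
      · have : u ((1 : ℕ) : ℤ) = fun x => (2 * cos x) - b 0 := by
          funext x; exact h.u1 x
        simp only [this]
        rw [iteratedDeriv_fun_sub (two_cos_smoothAt j θ) contDiffAt_const]
        refine (abs_sub _ _).trans ?_
        linarith [iteratedDeriv_const_bound j (b 0) θ, abs_iteratedDeriv_two_cos j θ]
      · intro n
        have hfun : u ((n + 2 : ℕ) : ℤ) = fun x => (2 * cos x) * u ((n + 1 : ℕ) : ℤ) x
            - (b (n + 1) * u ((n + 1 : ℕ) : ℤ) x + γ (n + 1) * u n x) := by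
          funext x
          have := h.hrec (n + 1) (by positivity) x
          rw [show (n : ℤ) + 1 - 1 = n by ring, show (n : ℤ) + 1 + 1 = ((n + 2 : ℕ) : ℤ) by push_cast; ring,
            show (n : ℤ) + 1 = ((n + 1 : ℕ) : ℤ) by push_cast; ring] at this
          rw [show (n : ℤ) + 1 = ((n + 1 : ℕ) : ℤ) by push_cast; ring]
          linarith
        have e1 : iteratedDeriv j (u ((n + 2 : ℕ) : ℤ)) θ =
            iteratedDeriv j ((fun x => 2 * cos x) * u ((n + 1 : ℕ) : ℤ)) θ
            - (b (n + 1) * iteratedDeriv j (u ((n + 1 : ℕ) : ℤ)) θ + γ (n + 1) * iteratedDeriv j (u n) θ) := by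
          rw [hfun, iteratedDeriv_fun_sub ((two_cos_smoothAt j θ).mul (h.smoothAt _ j θ))
            ((contDiffAt_const.mul (h.smoothAt _ j θ)).add (contDiffAt_const.mul (h.smoothAt _ j θ))),
            iteratedDeriv_fun_add (contDiffAt_const.mul (h.smoothAt _ j θ)) (contDiffAt_const.mul (h.smoothAt _ j θ)),
            iteratedDeriv_const_mul_field, iteratedDeriv_const_mul_field]
          rfl
        rw [e1, iteratedDeriv_mul (two_cos_smoothAt j θ) (h.smoothAt _ j θ), Finset.sum_range_succ']
        simp only [Nat.choose_zero_right, iteratedDeriv_zero, Nat.cast_one, Nat.sub_zero]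
        ring
      · intro n
        have hw : jkWt ((n : ℤ) + 1) = (n : ℝ) + 2 := by
          rw [show (n : ℤ) + 1 = ((n + 1 : ℕ) : ℤ) by push_cast; ring, jkWt_natCast]; push_cast; ring
        have b1 := hKb () (n + 1)
        have b2 := hKg () (n + 1)
        rw [hw] at b1 b2
        rw [if_pos (by omega)] at b2
        have hs : |∑ i ∈ Finset.range j, ((j.choose (i + 1) : ℕ) : ℝ) *
            iteratedDeriv (i + 1) (fun x => 2 * cos x) θ * iteratedDeriv (j - (i + 1)) (u ((n + 1 : ℕ) : ℤ)) θ|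
            ≤ (∑ i ∈ Finset.range j, ((j.choose (i + 1) : ℕ) : ℝ) * 2 * C) * ((n : ℝ) + 2) ^ q := by
          refine (Finset.abs_sum_le_sum_abs _ _).trans ?_
          rw [Finset.sum_mul]
          refine Finset.sum_le_sum fun i hi => ?_
          rw [abs_mul, abs_mul, Nat.abs_cast, mul_assoc _ C]
          have h1 := hb (j - (i + 1)) (by have := Finset.mem_range.mp hi; omega) (n + 1) θ
          rw [show ((n + 1 : ℕ) : ℝ) + 1 = (n : ℝ) + 2 by push_cast; ring] at h1
          exact mul_le_mul (mul_le_mul_of_nonneg_left (abs_iteratedDeriv_two_cos _ _) (by positivity)) h1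
            (abs_nonneg _) (by positivity)
        have hz2 : ((n : ℝ) + 2) ^ (-2 : ℤ) = 1 / ((n : ℝ) + 2) ^ 2 := by
          rw [zpow_neg, one_div]; norm_cast
        rw [hz2] at b1 b2
        have t1 : |b (n + 1) * iteratedDeriv j (u ((n + 1 : ℕ) : ℤ)) θ| ≤
            Kb * (1 / ((n : ℝ) + 2) ^ 2) * |iteratedDeriv j (u ((n + 1 : ℕ) : ℤ)) θ| := by
          rw [abs_mul]; exact mul_le_mul_of_nonneg_right b1 (abs_nonneg _)
        have t2 : |(γ (n + 1) - 1) * iteratedDeriv j (u n) θ| ≤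
            Kg * (1 / ((n : ℝ) + 2) ^ 2) * |iteratedDeriv j (u n) θ| := by
          rw [abs_mul]; exact mul_le_mul_of_nonneg_right b2 (abs_nonneg _)
        have t3 : 0 ≤ Kb * (1 / ((n : ℝ) + 2) ^ 2) * |iteratedDeriv j (u n) θ| := by positivity
        have t4 : 0 ≤ Kg * (1 / ((n : ℝ) + 2) ^ 2) * |iteratedDeriv j (u ((n + 1 : ℕ) : ℤ)) θ| := by positivity
        refine (abs_sub _ _).trans ((add_le_add (abs_sub _ _) le_rfl).trans ?_)
        rw [div_eq_mul_one_div]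
        nlinarith
    refine ⟨C + C', q + q', by positivity, fun i hi n θ => ?_⟩
    have hn : (1 : ℝ) ≤ (n : ℝ) + 1 := by linarith [(Nat.cast_nonneg n : (0 : ℝ) ≤ n)]
    have p1 : ((n : ℝ) + 1) ^ q ≤ ((n : ℝ) + 1) ^ (q + q') := pow_le_pow_right₀ hn (by omega)
    have p2 : ((n : ℝ) + 1) ^ q' ≤ ((n : ℝ) + 1) ^ (q + q') := pow_le_pow_right₀ hn (by omega)
    have p3 : 0 ≤ ((n : ℝ) + 1) ^ (q + q') := by positivity
    rcases Nat.lt_succ_iff_lt_or_eq.mp hi with h1 | rfl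
    · refine (hb i h1 n θ).trans ?_
      nlinarith
    · refine (new n θ).trans ?_
      nlinarith

lemma JSys.growthZ (h : JSys u b γ W) (j : ℕ) : ∃ (C : ℝ) (q : ℕ), 0 ≤ C ∧ ∀ i < j, ∀ (n : ℤ) (θ : ℝ),
    |iteratedDeriv i (u n) θ| ≤ C * jkWt n ^ q := by
  obtain ⟨C, q, hC, hb⟩ := h.growth j
  refine ⟨C, q, hC, fun i hi n θ => ?_⟩
  rcases lt_or_ge n 0 with hn | hn
  · have : u n = fun _ => (0 : ℝ) := by funext x; exact h.uneg n hn x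
    rw [this]
    refine (iteratedDeriv_const_bound i 0 θ).trans ?_
    rw [abs_zero]
    exact mul_nonneg hC (pow_nonneg (jkWt_pos n).le _)
  · lift n to ℕ using hn
    rw [jkWt_natCast]
    exact hb i hi n θ

lemma JSys.γsymb (h : JSys u b γ W) : Symb 0 (fun (_ : Unit) n => γ n) := by
  have h1 := (h.hγ.mono (show (-2 : ℤ) ≤ 0 by norm_num)).add (symb_cut 1)
  simpa using h1

lemma JSys.Wbound (h : JSys u b γ W) : PolyB W := by
  obtain ⟨Kg, hKg0, hKg⟩ := (h.hγ 0).bound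
  -- 1/γ ≤ 1 + κ/(n+1)
  obtain ⟨N, hN⟩ := exists_nat_ge (2 * Kg)
  have hbig : ∀ n : ℕ, N ≤ n → (γ (n + 1))⁻¹ ≤ 1 + (2 * Kg) / ((n : ℝ) + 1) := by
    intro n hn
    have hw : jkWt ((n : ℤ) + 1) = (n : ℝ) + 2 := by
      rw [show (n : ℤ) + 1 = ((n + 1 : ℕ) : ℤ) by push_cast; ring, jkWt_natCast]; push_cast; ring
    have b2 := hKg () (n + 1)
    rw [hw, if_pos (by omega)] at b2
    have hz2 : ((n : ℝ) + 2) ^ (-2 : ℤ) = 1 / ((n : ℝ) + 2) ^ 2 := by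
      rw [zpow_neg, one_div]; norm_cast
    rw [hz2] at b2
    have hn' : (N : ℝ) ≤ n := by exact_mod_cast hn
    have hn0 : (0 : ℝ) ≤ n := by positivity
    have h3 : Kg * (1 / ((n : ℝ) + 2) ^ 2) ≤ Kg / ((n : ℝ) + 1) * (1 / 2) := by
      rw [mul_one_div, div_mul_div_comm, mul_one]
      apply div_le_div_of_nonneg_left hKg0 (by positivity)
      nlinarith
    have hx : Kg / ((n : ℝ) + 1) ≤ 1 / 2 := by
      rw [div_le_iff₀ (by positivity)]; linarith
    have hx0 : 0 ≤ Kg / ((n : ℝ) + 1) := by positivity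
    have h4 := (abs_le.mp (b2.trans h3)).1
    rw [mul_div_assoc]
    rw [inv_le_iff_one_le_mul₀ (h.γpos _ (by omega))]
    nlinarith
  have hex : ∃ κ : ℕ, ∀ n : ℕ, (γ (n + 1))⁻¹ ≤ 1 + κ / ((n : ℝ) + 1) := by
    obtain ⟨κ, hκ⟩ := exists_nat_ge (2 * Kg + ∑ n ∈ Finset.range N, (γ (n + 1))⁻¹ * ((n : ℝ) + 1))
    have hpos : ∀ n : ℕ, 0 < (γ ((n : ℤ) + 1))⁻¹ := fun n => inv_pos.mpr (h.γpos _ (by omega))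
    refine ⟨κ, fun n => ?_⟩
    have hs0 : 0 ≤ ∑ n ∈ Finset.range N, (γ ((n : ℤ) + 1))⁻¹ * ((n : ℝ) + 1) :=
      Finset.sum_nonneg fun n _ => mul_nonneg (hpos n).le (by positivity)
    by_cases hn : N ≤ n
    · refine (hbig n hn).trans ?_
      gcongr
      linarith
    · have := Finset.single_le_sum (f := fun n : ℕ => (γ ((n : ℤ) + 1))⁻¹ * ((n : ℝ) + 1))
        (fun n _ => mul_nonneg (hpos n).le (by positivity)) (Finset.mem_range.mpr (not_le.mp hn))
      have h2 : (γ ((n : ℤ) + 1))⁻¹ ≤ κ / ((n : ℝ) + 1) := by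
        rw [le_div_iff₀ (by positivity)]; linarith
      linarith
  obtain ⟨κ, hκ⟩ := hex
  have hWn : ∀ n : ℕ, 0 ≤ W n := by
    intro n
    induction n with
    | zero => exact h.W0
    | succ n ih =>
      have h1 := h.Wrec n (by positivity)
      have h2 := h.γpos (n + 1) (by omega)
      push_cast
      rw [← h1] at ih
      exact nonneg_of_mul_nonneg_right ih h2
  have hg := gronwall_poly (fun n : ℕ => W n) κ 0 0 le_rfl h.W0 (by
    intro n
    have h1 := h.Wrec n (by positivity)
    have h2 := h.γpos (n + 1) (by omega)
    have h3 : W ((n + 1 : ℕ) : ℤ) = (γ (n + 1))⁻¹ * W n := by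
      rw [← h1]; push_cast; field_simp
    simp only [zero_mul, add_zero]
    rw [h3]
    exact mul_le_mul_of_nonneg_right (hκ n) (hWn n))
  refine ⟨W 0, κ + 0 + 1, h.W0, fun n => ?_⟩
  rcases lt_or_ge n 0 with hn | hn
  · rw [h.Wneg n hn, abs_zero]
    exact mul_nonneg h.W0 (pow_nonneg (jkWt_pos n).le _)
  · lift n to ℕ using hn
    rw [jkWt_natCast, abs_of_nonneg (hWn n)]
    simpa using hg n

end part4

section part5

lemma series_deriv {α : Type} (f : α → ℝ → ℝ) (hf : ∀ i, ContDiff ℝ (⊤ : ℕ∞) (f i)) (v : α → ℝ)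
    (hv : Summable v) (j : ℕ) (hb : ∀ k ≤ j, ∀ i x, |iteratedDeriv k (f i) x| ≤ v i) :
    ContDiff ℝ j (fun y => ∑' i, f i y) ∧ ∀ k ≤ j, ∀ x,
      iteratedDeriv k (fun y => ∑' i, f i y) x = ∑' i, iteratedDeriv k (f i) x ∧
      Summable (fun i => iteratedDeriv k (f i) x) ∧
      |iteratedDeriv k (fun y => ∑' i, f i y) x| ≤ ∑' i, v i := by
  have hf' : ∀ i, ContDiff ℝ ((j : ℕ∞) : WithTop ℕ∞) (f i) := fun i => (hf i).of_le (by exact_mod_cast le_top)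
  have hb' : ∀ (k : ℕ) (i : α) (x : ℝ), (k : ℕ∞) ≤ (j : ℕ∞) → ‖iteratedFDeriv ℝ k (f i) x‖ ≤ v i := by
    intro k i x hk
    rw [norm_iteratedFDeriv_eq_norm_iteratedDeriv]
    exact hb k (by exact_mod_cast hk) i x
  refine ⟨?_, fun k hk x => ?_⟩
  · exact contDiff_tsum (N := (j : ℕ∞)) hf' (fun k _ => hv) (v := fun _ => v) (fun k i x hk => hb' k i x (by exact_mod_cast hk))
  · have hs : Summable (fun i => iteratedDeriv k (f i) x) :=
      Summable.of_norm_bounded hv (fun i => hb k hk i x)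
    have e : iteratedDeriv k (fun y => ∑' i, f i y) x = ∑' i, iteratedDeriv k (f i) x := by
      have := iteratedFDeriv_tsum_apply (N := (j : ℕ∞)) hf' (fun k _ => hv) (v := fun _ => v)
        (fun k i x hk => hb' k i x hk) (k := k) (by exact_mod_cast hk) x
      simp only [iteratedDeriv_eq_equiv_comp, Function.comp_apply]
      rw [this]
      exact (ContinuousMultilinearMap.piFieldEquiv ℝ (Fin k) ℝ).symm.toContinuousLinearEquiv.map_tsum
    refine ⟨e, hs, ?_⟩
    rw [e]
    exact tsum_of_norm_bounded (f := fun i => iteratedDeriv k (f i) x) hv.hasSum (fun i => hb k hk i x)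

/-- diagonal exponential array -/
def expDiag (τ t : ℝ) : ℤ → ℤ → ℝ := fun n k =>
  if k = n then (if 1 ≤ n then exp (-t * (n + τ)) else 0) else 0

lemma expDecay (τ : ℝ) (hτ : -1 < τ) (p : ℕ) : ∃ C : ℝ, 0 ≤ C ∧ ∀ t : ℝ, 0 < t → ∀ n : ℤ, 1 ≤ n →
    t ^ p * exp (-t * (n + τ)) ≤ C * jkWt n ^ (-(p : ℤ)) := by
  obtain ⟨δ, hδ0, hδ1, hδ2⟩ : ∃ δ : ℝ, 0 < δ ∧ δ ≤ 1 ∧ 2 * δ ≤ 1 + τ :=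
    ⟨min 1 ((1 + τ) / 2), lt_min one_pos (by linarith), min_le_left _ _,
      by linarith [min_le_right 1 ((1 + τ) / 2)]⟩
  refine ⟨p.factorial / δ ^ p, by positivity, fun t ht n hn => ?_⟩
  have hn' : (1 : ℝ) ≤ n := by exact_mod_cast hn
  have hw : jkWt n = n + 1 := by
    unfold jkWt; rw [abs_of_pos (by linarith)]; ring
  have hx : δ * jkWt n ≤ n + τ := by
    rw [hw]; nlinarith
  have hwp := jkWt_pos n
  have hx0 : 0 < n + τ := lt_of_lt_of_le (by positivity) hx
  have h1 := Real.pow_div_factorial_le_exp (x := t * (n + τ)) (by positivity) p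
  rw [zpow_neg, zpow_natCast, ← div_eq_mul_inv, div_div, ← mul_pow, neg_mul, Real.exp_neg,
    ← div_eq_mul_inv, div_le_div_iff₀ (exp_pos _) (by positivity)]
  rw [div_le_iff₀ (by positivity), mul_pow] at h1
  have h2 : (δ * jkWt n) ^ p ≤ (n + τ) ^ p := pow_le_pow_left₀ (by positivity) hx p
  calc t ^ p * (δ * jkWt n) ^ p ≤ t ^ p * (n + τ) ^ p := by gcongr
    _ ≤ _ := by linarith

lemma expDiag_symb_aux {ι : Type} (T : ι → ℝ) (hT : ∀ i, 0 < T i) (τ : ℝ) (hτ : -1 < τ) (m : ℤ)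
    (H : ∀ k : ℕ, ∃ C : ℝ, ∀ i (n : ℤ), 1 ≤ n →
      (1 - exp (-T i)) ^ k * exp (-T i * (n + τ)) ≤ C * jkWt n ^ (m - k)) :
    BandSymb m (fun i => expDiag τ (T i)) := by
  constructor
  · refine ⟨0, fun i n k h => ?_⟩
    unfold expDiag
    rw [if_neg]
    rintro rfl
    simp at h
  · intro d
    by_cases hd : d = 0
    · subst hd
      simpa [expDiag] using symb_exp T hT τ hτ m H
    · have : (fun (i : ι) (n : ℤ) => expDiag τ (T i) n (n + d)) = fun _ _ => 0 := by
        funext i n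
        unfold expDiag
        rw [if_neg]
        intro h; apply hd; linarith
      rw [this]
      exact fun K => symbK_zero K m

lemma expDiag_band (τ : ℝ) (hτ : -1 < τ) :
    BandSymb 0 (fun t : {t : ℝ // 0 < t} => expDiag τ t.1) := by
  refine expDiag_symb_aux _ (fun t => t.2) τ hτ 0 fun k => ?_
  obtain ⟨C, hC, h⟩ := expDecay τ hτ k
  refine ⟨C, fun t n hn => ?_⟩
  rw [zero_sub]
  refine le_trans ?_ (h t.1 t.2 n hn)
  have h0 : 0 ≤ 1 - exp (-t.1) := by
    have : exp (-t.1) ≤ 1 := Real.exp_le_one_iff.mpr (by linarith [t.2])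
    linarith
  have h1 : 1 - exp (-t.1) ≤ t.1 := by linarith [Real.add_one_le_exp (-t.1)]
  gcongr

lemma expDiag_rapid (τ : ℝ) (hτ : -1 < τ) (t : ℝ) (ht : 0 < t) : RapidB (expDiag τ t) := by
  intro m
  refine expDiag_symb_aux (fun _ : Unit => t) (fun _ => ht) τ hτ m fun k => ?_
  obtain ⟨p, hp⟩ : ∃ p : ℕ, -(p : ℤ) ≤ m - k := ⟨(m - k).natAbs, by omega⟩
  obtain ⟨C, hC, h⟩ := expDecay τ hτ p
  refine ⟨C / t ^ p, fun _ n hn => ?_⟩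
  have h0 : 0 ≤ 1 - exp (-t) := by
    have : exp (-t) ≤ 1 := Real.exp_le_one_iff.mpr (by linarith)
    linarith
  have h1 : (1 - exp (-t)) ^ k ≤ 1 := pow_le_one₀ h0 (by linarith [exp_pos (-t)])
  have h2 := h t ht n hn
  have h3 : exp (-t * (n + τ)) ≤ C / t ^ p * jkWt n ^ (-(p : ℤ)) := by
    rw [div_mul_eq_mul_div, le_div_iff₀ (by positivity)]; linarith
  calc (1 - exp (-t)) ^ k * exp (-t * (n + τ)) ≤ 1 * exp (-t * (n + τ)) := by gcongr
    _ ≤ C / t ^ p * jkWt n ^ (-(p : ℤ)) := by rw [one_mul]; exact h3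
    _ ≤ C / t ^ p * jkWt n ^ (m - k) := by
      have := jkWt_zpow_mono hp n
      gcongr

lemma BandSymb.adT_iter {ι : Type} {F : ι → ℤ → ℤ → ℝ} {m : ℤ} (hF : BandSymb m F) {A B C : ℤ → ℝ}
    (hA : Symb 0 (fun (_ : Unit) n => A n)) (hB : Symb 0 (fun (_ : Unit) n => B n))
    (hC : Symb 0 (fun (_ : Unit) n => C n)) (M : ℕ) :
    BandSymb (m - M) (fun i => (_root_.adT A B C)^[M] (F i)) := by
  induction M with
  | zero => simpa using hF
  | succ M ih =>
    have := ih.adT hA hB hC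
    simp only [Function.iterate_succ_apply']
    convert this using 1
    push_cast; ring

lemma RapidB.adT_iter {F : ℤ → ℤ → ℝ} (hF : RapidB F) {A B C : ℤ → ℝ}
    (hA : Symb 0 (fun (_ : Unit) n => A n)) (hB : Symb 0 (fun (_ : Unit) n => B n))
    (hC : Symb 0 (fun (_ : Unit) n => C n)) (M : ℕ) : RapidB ((_root_.adT A B C)^[M] F) := by
  induction M with
  | zero => simpa using hF
  | succ M ih =>
    simp only [Function.iterate_succ_apply']
    exact ih.adT hA hB hC

lemma RapidB.tsum_adT_iter {F : ℤ → ℤ → ℝ} (hF : RapidB F) {A B C : ℤ → ℝ}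
    (hA : Symb 0 (fun (_ : Unit) n => A n)) (hB : Symb 0 (fun (_ : Unit) n => B n))
    (hC : Symb 0 (fun (_ : Unit) n => C n)) {u v : ℤ → ℝ} (hu : PolyB u) (hv : PolyB v) {x y : ℝ}
    (hx : ∀ n, x * u n = A n * u (n + 1) + B n * u n + C n * u (n - 1))
    (hy : ∀ n, y * v n = C (n + 1) * v (n + 1) + B n * v n + A (n - 1) * v (n - 1)) (M : ℕ) :
    ∑' z : ℤ × ℤ, (_root_.adT A B C)^[M] F z.1 z.2 * u z.1 * v z.2 =
      (x - y) ^ M * ∑' z : ℤ × ℤ, F z.1 z.2 * u z.1 * v z.2 := by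
  induction M with
  | zero => simp
  | succ M ih =>
    simp only [Function.iterate_succ_apply']
    rw [(hF.adT_iter hA hB hC M).tsum_adT hA hB hC hu hv hx hy, ih]
    ring

section core
variable {u : ℤ → ℝ → ℝ} {b γ W : ℤ → ℝ}

lemma JSys.polyB_u (h : JSys u b γ W) (θ : ℝ) : PolyB (fun n => u n θ) := by
  obtain ⟨C, q, hC, hb⟩ := h.growthZ 1
  exact ⟨C, q, hC, fun n => by simpa using hb 0 one_pos n θ⟩

lemma JSys.polyB_Q (h : JSys u b γ W) (φ : ℝ) : PolyB (fun n => W n * u n φ) :=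
  h.Wbound.mul (h.polyB_u φ)

lemma JSys.hx (h : JSys u b γ W) (θ : ℝ) (n : ℤ) :
    2 * cos θ * u n θ = (if 0 ≤ n then 1 else 0) * u (n + 1) θ + b n * u n θ + γ n * u (n - 1) θ := by
  rcases lt_or_ge n 0 with hn | hn
  · rw [h.uneg n hn, h.uneg (n - 1) (by omega), if_neg (by omega)]; ring
  · rw [if_pos hn, h.hrec n hn θ]; ring

lemma JSys.hy (h : JSys u b γ W) (φ : ℝ) (n : ℤ) :
    2 * cos φ * (W n * u n φ) = γ (n + 1) * (W (n + 1) * u (n + 1) φ) + b n * (W n * u n φ)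
      + (if 0 ≤ n - 1 then 1 else 0) * (W (n - 1) * u (n - 1) φ) := by
  rcases lt_or_ge n 0 with hn | hn
  · rw [h.uneg n hn, h.uneg (n - 1) (by omega), h.γneg (n + 1) (by omega)]; ring
  · have h1 := h.Wrec n hn
    have h2 := h.hrec n hn φ
    rcases eq_or_lt_of_le hn with h0 | h0
    · subst h0
      rw [h.γneg 0 le_rfl] at h2
      simp at h2 h1 ⊢
      linear_combination (W 0) * h2 - u 1 φ * h1
    · have h3 := h.Wrec (n - 1) (by omega)
      rw [if_pos (by omega)]
      rw [show n - 1 + 1 = n by ring] at h3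
      linear_combination (W n) * h2 - u (n + 1) φ * h1 + u (n - 1) φ * h3

/-- uniform derivative bounds for banded families -/
lemma JSys.band_deriv (h : JSys u b γ W) (φ : ℝ) (j : ℕ) : ∃ p : ℕ, ∀ {ι : Type} (F : ι → ℤ → ℤ → ℝ),
    BandSymb (-(2 * p : ℤ)) F → ∃ B : ℝ, 0 ≤ B ∧ ∀ i : ι,
      ContDiff ℝ j (fun θ => ∑' z : ℤ × ℤ, F i z.1 z.2 * u z.1 θ * (W z.2 * u z.2 φ)) ∧
      ∀ k ≤ j, ∀ θ,
        iteratedDeriv k (fun θ => ∑' z : ℤ × ℤ, F i z.1 z.2 * u z.1 θ * (W z.2 * u z.2 φ)) θ =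
          ∑' z : ℤ × ℤ, F i z.1 z.2 * iteratedDeriv k (u z.1) θ * (W z.2 * u z.2 φ) ∧
        Summable (fun z : ℤ × ℤ => F i z.1 z.2 * iteratedDeriv k (u z.1) θ * (W z.2 * u z.2 φ)) ∧
        |iteratedDeriv k (fun θ => ∑' z : ℤ × ℤ, F i z.1 z.2 * u z.1 θ * (W z.2 * u z.2 φ)) θ| ≤ B := by
  obtain ⟨C, q, hC, hb⟩ := h.growthZ (j + 1)
  obtain ⟨D, r, hD, hd⟩ := h.polyB_Q φ
  refine ⟨max q r + 2, fun {ι} F hF => ?_⟩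
  obtain ⟨E, hE0, hE⟩ := hF.decay
  have hS := summable_jkWt2.mul_left (E * C * D)
  have hder : ∀ i k θ (z : ℤ × ℤ), iteratedDeriv k (fun θ => F i z.1 z.2 * u z.1 θ * (W z.2 * u z.2 φ)) θ
      = F i z.1 z.2 * iteratedDeriv k (u z.1) θ * (W z.2 * u z.2 φ) := by
    intro i k θ z
    rw [iteratedDeriv_mul_const_field, iteratedDeriv_const_mul_field]
  have key : ∀ i, _ := fun i => series_deriv
      (fun (z : ℤ × ℤ) θ => F i z.1 z.2 * u z.1 θ * (W z.2 * u z.2 φ))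
      (fun z => (contDiff_const.mul (h.smooth z.1)).mul contDiff_const) _ hS j (by
        intro k hk z θ
        rw [hder]
        exact term_bound hC hD (hE i z.1 z.2)
          (PolyB.up hC (hb k (by omega) z.1 θ) (le_max_left _ _))
          (PolyB.up hD (hd z.2) (le_max_right _ _)))
  refine ⟨|∑' x : ℤ × ℤ, E * C * D * ((jkWt x.1 ^ 2)⁻¹ * (jkWt x.2 ^ 2)⁻¹)|, abs_nonneg _, fun i => ?_⟩
  obtain ⟨k1, k2⟩ := key i
  refine ⟨k1, fun k hk θ => ?_⟩
  obtain ⟨a1, a2, a3⟩ := k2 k hk θ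
  simp only [hder] at a1 a2
  exact ⟨a1, a2, a3.trans (le_abs_self _)⟩

end core
end part5

section part6
section core2
variable {u : ℤ → ℝ → ℝ} {b γ W : ℤ → ℝ}

lemma diag_inj : Function.Injective (fun n : ℕ => (((n : ℤ) + 1, (n : ℤ) + 1) : ℤ × ℤ)) := by
  intro a b hab
  simp at hab
  exact hab

lemma diag_zero (τ t : ℝ) (v w : ℤ → ℝ) (z : ℤ × ℤ)
    (hz : z ∉ Set.range (fun n : ℕ => (((n : ℤ) + 1, (n : ℤ) + 1) : ℤ × ℤ))) :
    expDiag τ t z.1 z.2 * v z.1 * w z.2 = 0 := by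
  unfold expDiag
  by_cases h1 : z.2 = z.1
  · by_cases h2 : 1 ≤ z.1
    · exfalso; apply hz
      refine ⟨(z.1 - 1).toNat, ?_⟩
      ext <;> simp <;> omega
    · rw [if_pos h1, if_neg h2]; ring
  · rw [if_neg h1]; ring

lemma diag_val (τ t : ℝ) (v w : ℤ → ℝ) (n : ℕ) :
    expDiag τ t (n + 1) (n + 1) * v (n + 1) * w (n + 1) =
      exp (-t * ((n : ℝ) + 1 + τ)) * v (n + 1) * w (n + 1) := by
  unfold expDiag
  rw [if_pos rfl, if_pos (by omega)]
  push_cast; rfl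

lemma diag_tsum (τ t : ℝ) (v w : ℤ → ℝ) :
    ∑' z : ℤ × ℤ, expDiag τ t z.1 z.2 * v z.1 * w z.2 =
      ∑' n : ℕ, exp (-t * ((n : ℝ) + 1 + τ)) * v (n + 1) * w (n + 1) := by
  have := diag_inj.tsum_eq (f := fun z : ℤ × ℤ => expDiag τ t z.1 z.2 * v z.1 * w z.2) (by
    intro z hz
    by_contra h
    exact hz (diag_zero τ t v w z h))
  rw [← this]
  exact tsum_congr fun n => diag_val τ t v w n

lemma diag_summable (τ t : ℝ) (v w : ℤ → ℝ)
    (hs : Summable (fun z : ℤ × ℤ => expDiag τ t z.1 z.2 * v z.1 * w z.2)) :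
    Summable (fun n : ℕ => exp (-t * ((n : ℝ) + 1 + τ)) * v (n + 1) * w (n + 1)) := by
  have := hs.comp_injective diag_inj
  refine this.congr fun n => ?_
  exact diag_val τ t v w n

/-- the abstract shifted kernel -/
def absKer (u : ℤ → ℝ → ℝ) (W : ℤ → ℝ) (τ t φ θ : ℝ) : ℝ :=
  ∑' n : ℕ, exp (-t * ((n : ℝ) + 1 + τ)) * u (n + 1) θ * (W (n + 1) * u (n + 1) φ)

lemma absKer_eq (u : ℤ → ℝ → ℝ) (W : ℤ → ℝ) (τ t φ : ℝ) :
    absKer u W τ t φ = fun θ => ∑' z : ℤ × ℤ, expDiag τ t z.1 z.2 * u z.1 θ * (W z.2 * u z.2 φ) := by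
  funext θ
  exact (diag_tsum τ t (fun n => u n θ) (fun n => W n * u n φ)).symm

lemma JSys.absKer_deriv (h : JSys u b γ W) (τ : ℝ) (hτ : -1 < τ) (t : ℝ) (ht : 0 < t) (φ : ℝ) (k : ℕ) :
    ContDiff ℝ k (absKer u W τ t φ) ∧ ∀ θ,
    Summable (fun n : ℕ => exp (-t * ((n : ℝ) + 1 + τ)) * iteratedDeriv k (u (n + 1)) θ * (W (n + 1) * u (n + 1) φ)) ∧
    iteratedDeriv k (absKer u W τ t φ) θ =
      ∑' n : ℕ, exp (-t * ((n : ℝ) + 1 + τ)) * iteratedDeriv k (u (n + 1)) θ * (W (n + 1) * u (n + 1) φ) := by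
  obtain ⟨p, hp⟩ := h.band_deriv φ k
  obtain ⟨B, -, hB⟩ := hp (fun _ : Unit => expDiag τ t) (expDiag_rapid τ hτ t ht _)
  rw [absKer_eq]
  refine ⟨(hB ()).1, fun θ => ?_⟩
  obtain ⟨a1, a2, -⟩ := (hB ()).2 k le_rfl θ
  refine ⟨diag_summable τ t (fun n => iteratedDeriv k (u n) θ) (fun n => W n * u n φ) a2, ?_⟩
  rw [a1]
  exact diag_tsum τ t (fun n => iteratedDeriv k (u n) θ) (fun n => W n * u n φ)

lemma cosdiff_bound (φ θ : ℝ) (hne : cos θ ≠ cos φ) (M j : ℕ) :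
    ∃ (r C : ℝ), 0 < r ∧ 0 ≤ C ∧ ∀ θ' ∈ Metric.ball θ r, cos θ' ≠ cos φ ∧ ∀ k ≤ j,
      |iteratedDeriv k (fun x => ((2 * cos x - 2 * cos φ) ^ M)⁻¹) θ'| ≤ C := by
  let U : Set ℝ := {x | cos x ≠ cos φ}
  have hU : IsOpen U := isOpen_ne_fun Real.continuous_cos continuous_const
  have hcd : ContDiffOn ℝ (⊤ : ℕ∞) (fun x => ((2 * cos x - 2 * cos φ) ^ M)⁻¹) U := by
    apply ContDiffOn.inv
    · exact (((contDiff_const.mul Real.contDiff_cos).sub contDiff_const).pow M).contDiffOn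
    · intro x hx
      apply pow_ne_zero
      intro h0; apply hx; linarith
  have hev : ∀ k ∈ Finset.range (j + 1), ∀ᶠ x in nhds θ,
      |iteratedDeriv k (fun x => ((2 * cos x - 2 * cos φ) ^ M)⁻¹) x| ≤
      |iteratedDeriv k (fun x => ((2 * cos x - 2 * cos φ) ^ M)⁻¹) θ| + 1 := by
    intro k _
    have h1 := hcd.continuousOn_iteratedDerivWithin (m := k) (by exact_mod_cast le_top) hU.uniqueDiffOn
    have h2 : ContinuousOn (iteratedDeriv k (fun x => ((2 * cos x - 2 * cos φ) ^ M)⁻¹)) U :=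
      h1.congr (fun x hx => (iteratedDerivWithin_of_isOpen hU hx).symm)
    have h3 := (h2.continuousAt (hU.mem_nhds hne)).abs
    exact (h3.eventually_lt continuousAt_const (lt_add_one _)).mono fun x hx => hx.le
  have hall := ((Finset.range (j + 1)).eventually_all (l := nhds θ)).mpr hev
  obtain ⟨r, hr, hball⟩ := Metric.eventually_nhds_iff_ball.mp (hall.and (hU.mem_nhds hne))
  refine ⟨r, ∑ k ∈ Finset.range (j + 1),
    (|iteratedDeriv k (fun x => ((2 * cos x - 2 * cos φ) ^ M)⁻¹) θ| + 1), hr,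
    Finset.sum_nonneg fun k _ => by positivity, fun θ' hθ' => ⟨(hball θ' hθ').2, fun k hk => ?_⟩⟩
  have hk' : k ∈ Finset.range (j + 1) := Finset.mem_range.mpr (by omega)
  refine ((hball θ' hθ').1 k hk').trans ?_
  exact Finset.single_le_sum (f := fun k => |iteratedDeriv k (fun x => ((2 * cos x - 2 * cos φ) ^ M)⁻¹) θ| + 1)
    (fun k _ => by positivity) hk'

theorem JSys.core_bound (h : JSys u b γ W) (τ : ℝ) (hτ : -1 < τ) (φ θ : ℝ) (hne : cos θ ≠ cos φ) (j : ℕ) :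
    ∃ (r C : ℝ), 0 < r ∧ 0 ≤ C ∧ ∀ t, 0 < t → ∀ θ' ∈ Metric.ball θ r, ∀ k ≤ j,
      |iteratedDeriv k (absKer u W τ t φ) θ'| ≤ C := by
  obtain ⟨p, hp⟩ := h.band_deriv φ j
  have hA : Symb 0 (fun (_ : Unit) n => (fun n : ℤ => if 0 ≤ n then (1 : ℝ) else 0) n) := symb_cut 0
  have hb0 := h.hb.mono (show (-2 : ℤ) ≤ 0 by norm_num)
  obtain ⟨B, hB0, hB⟩ := hp _ (by
    have := (expDiag_band τ hτ).adT_iter hA hb0 h.γsymb (2 * p)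
    simpa using this)
  obtain ⟨r, D, hr, hD, hd⟩ := cosdiff_bound φ θ hne (2 * p) j
  refine ⟨r, ∑ k ∈ Finset.range (j + 1), ∑ i ∈ Finset.range (k + 1), (k.choose i : ℝ) * B * D, hr,
    Finset.sum_nonneg fun k _ => Finset.sum_nonneg fun i _ => by positivity, fun t ht θ' hθ' k hk => ?_⟩
  obtain ⟨c1, c2⟩ := hB ⟨t, ht⟩
  set R : ℝ → ℝ := fun θ => ∑' z : ℤ × ℤ,
    (_root_.adT (fun n : ℤ => if 0 ≤ n then (1 : ℝ) else 0) b γ)^[2 * p] (expDiag τ t) z.1 z.2 * u z.1 θ *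
      (W z.2 * u z.2 φ) with hR
  have hRS : ∀ x, R x = (2 * cos x - 2 * cos φ) ^ (2 * p) * absKer u W τ t φ x := by
    intro x
    rw [absKer_eq]
    exact (expDiag_rapid τ hτ t ht).tsum_adT_iter hA hb0 h.γsymb (h.polyB_u x) (h.polyB_Q φ)
      (h.hx x) (h.hy φ) (2 * p)
  have hev : absKer u W τ t φ =ᶠ[nhds θ'] (R * fun x => ((2 * cos x - 2 * cos φ) ^ (2 * p))⁻¹) := by
    filter_upwards [Metric.isOpen_ball.mem_nhds hθ'] with x hx
    have hx1 := (hd x hx).1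
    have : (2 * cos x - 2 * cos φ) ≠ 0 := by
      intro h0; apply hx1; linarith
    simp only [Pi.mul_apply]
    rw [hRS x]; field_simp
  rw [hev.iteratedDeriv_eq k]
  have hne' : (2 * cos θ' - 2 * cos φ) ^ (2 * p) ≠ 0 := by
    apply pow_ne_zero
    intro h0; apply (hd θ' hθ').1; linarith
  have hinv : ContDiffAt ℝ k (fun x => ((2 * cos x - 2 * cos φ) ^ (2 * p))⁻¹) θ' :=
    ContDiffAt.inv (((contDiff_const.mul Real.contDiff_cos).sub contDiff_const).pow _).contDiffAt hne'
  rw [iteratedDeriv_mul (c1.of_le (by exact_mod_cast hk)).contDiffAt hinv]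
  refine (Finset.abs_sum_le_sum_abs _ _).trans ?_
  refine le_trans (Finset.sum_le_sum (g := fun i => (k.choose i : ℝ) * B * D) fun i hi => ?_) ?_
  · rw [abs_mul, abs_mul, Nat.abs_cast]
    have hi' := Finset.mem_range.mp hi
    exact mul_le_mul (mul_le_mul_of_nonneg_left (c2 i (by omega) θ').2.2 (by positivity))
      ((hd θ' hθ').2 (k - i) (by omega)) (abs_nonneg _) (by positivity)
  · exact Finset.single_le_sum (f := fun k : ℕ => ∑ i ∈ Finset.range (k + 1), (k.choose i : ℝ) * B * D)
      (fun k _ => Finset.sum_nonneg fun i _ => by positivity) (Finset.mem_range.mpr (by omega))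

end core2
end part6

section part7
section interchange
variable {u : ℤ → ℝ → ℝ} {b γ W : ℤ → ℝ}

lemma absKer_shift (u : ℤ → ℝ → ℝ) (W : ℤ → ℝ) (τ ε t φ : ℝ) :
    absKer u W τ t φ = fun θ => exp (-ε * t) * absKer u W (τ - ε) t φ θ := by
  funext θ
  unfold absKer
  rw [← tsum_mul_left]
  refine tsum_congr fun n => ?_
  rw [show -t * ((n : ℝ) + 1 + τ) = -ε * t + -t * ((n : ℝ) + 1 + (τ - ε)) by ring, Real.exp_add]
  ring

lemma JSys.expbound (h : JSys u b γ W) (τ : ℝ) (hτ : -1 < τ) (φ θ : ℝ) (hne : cos θ ≠ cos φ) (j : ℕ) :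
    ∃ (r C : ℝ), 0 < r ∧ 0 ≤ C ∧ ∀ t, 0 < t → ∀ θ' ∈ Metric.ball θ r, ∀ k ≤ j,
      |iteratedDeriv k (absKer u W τ t φ) θ'| ≤ C * exp (-((1 + τ) / 2) * t) := by
  obtain ⟨r, C, hr, hC, hb⟩ := h.core_bound (τ - (1 + τ) / 2) (by linarith) φ θ hne j
  refine ⟨r, C, hr, hC, fun t ht θ' hθ' k hk => ?_⟩
  rw [absKer_shift u W τ ((1 + τ) / 2) t φ, iteratedDeriv_const_mul_field, abs_mul, abs_of_pos (exp_pos _),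
    mul_comm]
  exact mul_le_mul_of_nonneg_right (hb t ht θ' hθ' k hk) (exp_pos _).le

lemma JSys.meas (h : JSys u b γ W) (τ : ℝ) (hτ : -1 < τ) (φ θ : ℝ) (k m : ℕ) :
    AEStronglyMeasurable (fun t => iteratedDeriv k (absKer u W τ t φ) θ * t ^ m)
      (volume.restrict (Ioi 0)) := by
  refine AEStronglyMeasurable.mul ?_ (by fun_prop)
  refine aestronglyMeasurable_of_tendsto_ae atTop (f := fun (s : ℕ) t => ∑ n ∈ Finset.range s,
    exp (-t * ((n : ℝ) + 1 + τ)) * iteratedDeriv k (u (n + 1)) θ * (W (n + 1) * u (n + 1) φ))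
    (fun s => ?_) ?_
  · exact Continuous.aestronglyMeasurable (by fun_prop)
  · refine (ae_restrict_iff' measurableSet_Ioi).mpr (ae_of_all _ fun t ht => ?_)
    obtain ⟨h1, h2⟩ := (h.absKer_deriv τ hτ t ht φ k).2 θ
    rw [h2]
    exact h1.hasSum.tendsto_sum_nat

lemma bound_integrable (C ε : ℝ) (hε : 0 < ε) (m : ℕ) :
    Integrable (fun t => C * exp (-ε * t) * t ^ m) (volume.restrict (Ioi 0)) := by
  have := (integrableOn_rpow_mul_exp_neg_mul_rpow (p := 1) (s := m) (b := ε)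
    (by linarith [(Nat.cast_nonneg m : (0 : ℝ) ≤ m)]) one_pos hε).const_mul C
  refine this.congr ((ae_restrict_iff' measurableSet_Ioi).mpr (ae_of_all _ fun t ht => ?_))
  simp only [rpow_natCast, rpow_one]; ring

lemma JSys.integrable (h : JSys u b γ W) (τ : ℝ) (hτ : -1 < τ) (φ θ : ℝ) (hne : cos θ ≠ cos φ) (k m : ℕ) :
    Integrable (fun t => iteratedDeriv k (absKer u W τ t φ) θ * t ^ m) (volume.restrict (Ioi 0)) := by
  obtain ⟨r, C, hr, hC, hb⟩ := h.expbound τ hτ φ θ hne k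
  refine (bound_integrable C ((1 + τ) / 2) (by linarith) m).mono' (h.meas τ hτ φ θ k m) ?_
  refine (ae_restrict_iff' measurableSet_Ioi).mpr (ae_of_all _ fun t ht => ?_)
  have ht' : (0 : ℝ) < t := ht
  rw [norm_mul, Real.norm_eq_abs, Real.norm_eq_abs, abs_of_nonneg (pow_nonneg ht'.le m)]
  exact mul_le_mul_of_nonneg_right (hb t ht θ (Metric.mem_ball_self hr) k le_rfl) (by positivity)

theorem JSys.interchange (h : JSys u b γ W) (τ : ℝ) (hτ : -1 < τ) (φ : ℝ) (m j : ℕ) :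
    ∀ θ, cos θ ≠ cos φ →
    iteratedDeriv j (fun θ' => ∫ t in Ioi (0 : ℝ), absKer u W τ t φ θ' * t ^ m) θ =
      ∫ t in Ioi (0 : ℝ), iteratedDeriv j (absKer u W τ t φ) θ * t ^ m := by
  induction j with
  | zero => intro θ _; simp
  | succ j ih =>
    intro θ hne
    have hU : IsOpen {x | cos x ≠ cos φ} := isOpen_ne_fun Real.continuous_cos continuous_const
    rw [iteratedDeriv_succ]
    have hev : iteratedDeriv j (fun θ' => ∫ t in Ioi (0 : ℝ), absKer u W τ t φ θ' * t ^ m) =ᶠ[nhds θ]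
        fun θ' => ∫ t in Ioi (0 : ℝ), iteratedDeriv j (absKer u W τ t φ) θ' * t ^ m := by
      filter_upwards [hU.mem_nhds hne] with x hx
      exact ih x hx
    rw [hev.deriv_eq]
    obtain ⟨r, C, hr, hC, hb⟩ := h.expbound τ hτ φ θ hne (j + 1)
    refine (hasDerivAt_integral_of_dominated_loc_of_deriv_le (𝕜 := ℝ)
      (F := fun x t => iteratedDeriv j (absKer u W τ t φ) x * t ^ m)
      (F' := fun x t => iteratedDeriv (j + 1) (absKer u W τ t φ) x * t ^ m)
      (bound := fun t => C * exp (-((1 + τ) / 2) * t) * t ^ m)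
      (Metric.ball_mem_nhds θ hr) (Eventually.of_forall fun x => h.meas τ hτ φ x j m)
      (h.integrable τ hτ φ θ hne j m) (h.meas τ hτ φ θ (j + 1) m) ?_
      (bound_integrable C _ (by linarith) m) ?_).2.deriv
    · refine (ae_restrict_iff' measurableSet_Ioi).mpr (ae_of_all _ fun t ht x hx => ?_)
      have ht' : (0 : ℝ) < t := ht
      rw [norm_mul, Real.norm_eq_abs, Real.norm_eq_abs, abs_of_nonneg (pow_nonneg ht'.le m)]
      exact mul_le_mul_of_nonneg_right (hb t ht x hx (j + 1) le_rfl) (by positivity)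
    · refine (ae_restrict_iff' measurableSet_Ioi).mpr (ae_of_all _ fun t ht x hx => ?_)
      apply HasDerivAt.mul_const
      rw [iteratedDeriv_succ]
      have := (h.absKer_deriv τ hτ t ht φ (j + 1)).1
      exact ((this.differentiable_iteratedDeriv j (by exact_mod_cast Nat.lt_succ_self j)) x).hasDerivAt

end interchange
end part7

section part8
section jac
variable {α β : ℝ}

/-- Jacobi coefficients -/
def jco (α β : ℝ) (n k : ℕ) : ℝ := if k ≤ n then
    (Real.Gamma ((n:ℝ)+α+1) / (Real.Gamma (α+(k:ℝ)+1) * (Nat.factorial (n-k)))) *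
    (Real.Gamma ((n:ℝ)+β+1) / (Real.Gamma ((n:ℝ)+β-(k:ℝ)+1) * (Nat.factorial k))) else 0

lemma jco_zero_of_lt {n k : ℕ} (h : n < k) : jco α β n k = 0 := by
  unfold jco; rw [if_neg (by omega)]

lemma jco_R1 (hα : -1 < α) (hβ : -1 < β) (n k : ℕ) :
    jco α β n (k + 1) * (((k : ℝ) + 1) * (α + k + 1)) = jco α β n k * (((n : ℝ) - k) * (n + β - k)) := by
  rcases lt_trichotomy k n with h | h | h
  · obtain ⟨d, rfl⟩ := Nat.exists_eq_add_of_lt h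
    unfold jco
    rw [if_pos (by omega), if_pos (by omega)]
    rw [show k + d + 1 - (k + 1) = d by omega, show k + d + 1 - k = d + 1 by omega]
    rw [Nat.factorial_succ, Nat.factorial_succ]
    push_cast
    have h1 : (0 : ℝ) < α + k + 1 := by linarith [(Nat.cast_nonneg k : (0 : ℝ) ≤ k)]
    have h2 : (0 : ℝ) < d + 1 + β := by linarith [(Nat.cast_nonneg d : (0 : ℝ) ≤ d)]
    have g1 : Real.Gamma (α + (k + 1) + 1) = (α + k + 1) * Real.Gamma (α + k + 1) := by
      rw [← Real.Gamma_add_one h1.ne']; congr 1; ring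
    have g2 : Real.Gamma ((k : ℝ) + d + 1 + β - k + 1) = (d + 1 + β) * Real.Gamma ((k : ℝ) + d + 1 + β - (k + 1) + 1) := by
      rw [show (k : ℝ) + d + 1 + β - (k + 1) + 1 = d + 1 + β by ring, ← Real.Gamma_add_one h2.ne']
      congr 1; ring
    rw [g1, g2]
    have p1 := Real.Gamma_pos_of_pos h1
    have p2 : 0 < Real.Gamma ((k : ℝ) + d + 1 + β - (k + 1) + 1) := by
      rw [show (k : ℝ) + d + 1 + β - (k + 1) + 1 = d + 1 + β by ring]
      exact Real.Gamma_pos_of_pos h2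
    have f1 : (0 : ℝ) < (d.factorial : ℝ) := by positivity
    have f2 : (0 : ℝ) < (k.factorial : ℝ) := by positivity
    rw [show (k : ℝ) + d + 1 - k = d + 1 by ring, show (k : ℝ) + d + 1 + β - k = d + 1 + β by ring]
    generalize Real.Gamma ((k : ℝ) + d + 1 + β - (k + 1) + 1) = G1 at *
    generalize Real.Gamma (α + k + 1) = G2 at *
    field_simp
  · subst h; rw [jco_zero_of_lt (by omega)]; ring
  · rw [jco_zero_of_lt (by omega), jco_zero_of_lt (by omega)]; ring

lemma jco_R2 (hα : -1 < α) (hβ : -1 < β) (n k : ℕ) :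
    jco α β (n + 1) (k + 1) * (((k : ℝ) + 1) * (α + k + 1)) = jco α β n k * (((n : ℝ) + 1 + α) * (n + 1 + β)) := by
  rcases le_or_gt k n with h | h
  · obtain ⟨d, rfl⟩ := Nat.exists_eq_add_of_le h
    unfold jco
    rw [if_pos (by omega), if_pos (by omega)]
    rw [show k + d + 1 - (k + 1) = d by omega, show k + d - k = d by omega]
    rw [Nat.factorial_succ]
    push_cast
    have k0 : (0 : ℝ) ≤ k := by positivity
    have d0 : (0 : ℝ) ≤ d := by positivity
    have h1 : (0 : ℝ) < α + k + 1 := by linarith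
    have h2 : (0 : ℝ) < d + 1 + β := by linarith
    have h3 : (0 : ℝ) < k + d + α + 1 := by linarith
    have h4 : (0 : ℝ) < k + d + β + 1 := by linarith
    have g1 : Real.Gamma (α + (k + 1) + 1) = (α + k + 1) * Real.Gamma (α + k + 1) := by
      rw [← Real.Gamma_add_one h1.ne']; congr 1; ring
    have g2 : Real.Gamma ((k : ℝ) + d + 1 + β - (k + 1) + 1) = Real.Gamma ((k : ℝ) + d + β - k + 1) := by
      congr 1; ring
    have g3 : Real.Gamma ((k : ℝ) + d + 1 + α + 1) = (k + d + α + 1) * Real.Gamma ((k : ℝ) + d + α + 1) := by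
      rw [← Real.Gamma_add_one h3.ne']; congr 1; ring
    have g4 : Real.Gamma ((k : ℝ) + d + 1 + β + 1) = (k + d + β + 1) * Real.Gamma ((k : ℝ) + d + β + 1) := by
      rw [← Real.Gamma_add_one h4.ne']; congr 1; ring
    rw [g1, g2, g3, g4]
    have p1 := Real.Gamma_pos_of_pos h1
    have p2 : 0 < Real.Gamma ((k : ℝ) + d + β - k + 1) := by
      rw [show (k : ℝ) + d + β - k + 1 = d + 1 + β by ring]
      exact Real.Gamma_pos_of_pos h2
    have f1 : (0 : ℝ) < (d.factorial : ℝ) := by positivity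
    have f2 : (0 : ℝ) < (k.factorial : ℝ) := by positivity
    generalize Real.Gamma ((k : ℝ) + d + β - k + 1) = G1 at *
    generalize Real.Gamma (α + k + 1) = G2 at *
    generalize Real.Gamma ((k : ℝ) + d + β + 1) = G3 at *
    generalize Real.Gamma ((k : ℝ) + d + α + 1) = G4 at *
    field_simp
    ring
  · rw [jco_zero_of_lt (by omega), jco_zero_of_lt (by omega)]; ring

lemma jco_R3 (hα : -1 < α) (hβ : -1 < β) (n : ℕ) :
    jco α β (n + 1) 0 * ((n : ℝ) + 1) = jco α β n 0 * ((n : ℝ) + 1 + α) := by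
  unfold jco
  rw [if_pos (by omega), if_pos (by omega)]
  simp only [Nat.sub_zero, Nat.factorial_succ, Nat.factorial_zero]
  push_cast
  have d0 : (0 : ℝ) ≤ n := by positivity
  have h1 : (0 : ℝ) < n + α + 1 := by linarith
  have h2 : (0 : ℝ) < n + β + 1 := by linarith
  have h3 : (0 : ℝ) < n + 1 + β + 1 := by linarith
  have g3 : Real.Gamma ((n : ℝ) + 1 + α + 1) = (n + α + 1) * Real.Gamma (n + α + 1) := by
    rw [← Real.Gamma_add_one h1.ne']; congr 1; ring
  have p1 := Real.Gamma_pos_of_pos h2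
  have p2 := Real.Gamma_pos_of_pos h3
  have p3 : 0 < Real.Gamma (α + 0 + 1) := Real.Gamma_pos_of_pos (by linarith)
  have f1 : (0 : ℝ) < (n.factorial : ℝ) := by positivity
  rw [g3, sub_zero, sub_zero]
  generalize Real.Gamma ((n : ℝ) + β + 1) = G1 at *
  generalize Real.Gamma ((n : ℝ) + 1 + β + 1) = G2 at *
  generalize Real.Gamma (α + 0 + 1) = G3 at *
  field_simp
  ring

lemma jco_00 (hα : -1 < α) (hβ : -1 < β) : jco α β 0 0 = 1 := by
  unfold jco
  have p3 : 0 < Real.Gamma (α + 1) := Real.Gamma_pos_of_pos (by linarith)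
  have p4 : 0 < Real.Gamma (β + 1) := Real.Gamma_pos_of_pos (by linarith)
  simp [p3.ne', p4.ne']

/-- homogeneous sums -/
def hsum (f : ℕ → ℝ) (n : ℕ) (S U : ℝ) : ℝ := ∑ k ∈ Finset.range (n + 1), f k * S ^ k * U ^ (n - k)

lemma jacobiPoly_eq (n : ℕ) (x : ℝ) : jacobiPoly α β n x = hsum (jco α β n) n ((x - 1) / 2) ((x + 1) / 2) := by
  unfold jacobiPoly hsum
  refine Finset.sum_congr rfl fun k hk => ?_
  unfold jco
  rw [if_pos (by have := Finset.mem_range.mp hk; omega)]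

lemma hsum_U (f : ℕ → ℝ) (n : ℕ) (S U : ℝ) (h : f (n + 1) = 0) : U * hsum f n S U = hsum f (n + 1) S U := by
  unfold hsum
  rw [Finset.sum_range_succ _ (n + 1), h, Finset.mul_sum]
  simp only [zero_mul, add_zero]
  refine Finset.sum_congr rfl fun k hk => ?_
  rw [show n + 1 - k = (n - k) + 1 by have := Finset.mem_range.mp hk; omega, pow_succ]
  ring

def shf (f : ℕ → ℝ) : ℕ → ℝ
  | 0 => 0
  | k + 1 => f k

lemma hsum_S (f : ℕ → ℝ) (n : ℕ) (S U : ℝ) : S * hsum f n S U = hsum (shf f) (n + 1) S U := by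
  unfold hsum
  rw [Finset.sum_range_succ' _ (n + 1), Finset.mul_sum]
  simp only [shf, zero_mul, add_zero]
  refine Finset.sum_congr rfl fun k hk => ?_
  rw [show n + 1 - (k + 1) = n - k by omega, pow_succ]
  ring

lemma hsum_add (f g : ℕ → ℝ) (n : ℕ) (S U : ℝ) : hsum f n S U + hsum g n S U = hsum (fun k => f k + g k) n S U := by
  unfold hsum
  rw [← Finset.sum_add_distrib]
  exact Finset.sum_congr rfl fun k _ => by ring

lemma hsum_smul (a : ℝ) (f : ℕ → ℝ) (n : ℕ) (S U : ℝ) : a * hsum f n S U = hsum (fun k => a * f k) n S U := by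
  unfold hsum
  rw [Finset.mul_sum]
  exact Finset.sum_congr rfl fun k _ => by ring

def jA (α β : ℝ) (n : ℕ) : ℝ := if n = 0 then 2 / (α + β + 2) else
  2 * ((n : ℝ) + 1) * (n + α + β + 1) / ((2 * n + α + β + 1) * (2 * n + α + β + 2))
def jB (α β : ℝ) (n : ℕ) : ℝ := if n = 0 then (β - α) / (α + β + 2) else
  (β ^ 2 - α ^ 2) / ((2 * n + α + β) * (2 * n + α + β + 2))
/-- coefficient `C_{m+1}` -/
def jC (α β : ℝ) (m : ℕ) : ℝ :=
  2 * ((m : ℝ) + 1 + α) * (m + 1 + β) / ((2 * m + 2 + α + β) * (2 * m + 3 + α + β))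

lemma jacobi_zero (hα : -1 < α) (hβ : -1 < β) (x : ℝ) : jacobiPoly α β 0 x = 1 := by
  rw [jacobiPoly_eq]; simp [hsum, jco_00 hα hβ]

lemma jacobi_rec0 (hα : -1 < α) (hβ : -1 < β) (x : ℝ) :
    x * jacobiPoly α β 0 x = jA α β 0 * jacobiPoly α β 1 x + jB α β 0 * jacobiPoly α β 0 x := by
  rw [jacobi_zero hα hβ, jacobiPoly_eq]
  have r3 := jco_R3 hα hβ 0
  have r2 := jco_R2 hα hβ 0 0
  rw [jco_00 hα hβ] at r2 r3
  have h1 : (α + 1) ≠ 0 := by linarith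
  have h2 : α + β + 2 ≠ 0 := by linarith
  have e1 : jco α β 1 0 = 1 + α := by simpa using r3
  have e2 : jco α β 1 1 = 1 + β := by
    have : jco α β 1 1 * (α + 1) = (1 + β) * (α + 1) := by simp at r2; linarith
    exact mul_right_cancel₀ h1 this
  simp only [hsum, Finset.sum_range_succ, Finset.sum_range_zero, e1, e2, jA, jB, if_true]
  field_simp
  ring

lemma jacobi_rec (hα : -1 < α) (hβ : -1 < β) (m : ℕ) (x : ℝ) :
    x * jacobiPoly α β (m + 1) x = jA α β (m + 1) * jacobiPoly α β (m + 2) x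
      + jB α β (m + 1) * jacobiPoly α β (m + 1) x + jC α β m * jacobiPoly α β m x := by
  rw [jacobiPoly_eq, jacobiPoly_eq, jacobiPoly_eq]
  set S := (x - 1) / 2 with hS
  set U := (x + 1) / 2 with hU
  set A := jA α β (m + 1) with hA
  set B := jB α β (m + 1) with hB
  set C := jC α β m with hC
  have ex : x = U + S := by rw [hS, hU]; ring
  have e1 : U - S = 1 := by rw [hS, hU]; ring
  set g0 := jco α β m with hg0
  set g1 := jco α β (m + 1) with hg1
  set g2 := jco α β (m + 2) with hg2
  have z0 : g0 (m + 1) = 0 := jco_zero_of_lt (by omega)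
  have z0' : g0 (m + 2) = 0 := jco_zero_of_lt (by omega)
  have z1 : g1 (m + 2) = 0 := jco_zero_of_lt (by omega)
  have hU1 := hsum_U g1 (m + 1) S U z1
  have hS1 := hsum_S g1 (m + 1) S U
  have hU0 := hsum_U g0 m S U z0
  have hS0 := hsum_S g0 m S U
  have hUU0 := hsum_U g0 (m + 1) S U z0'
  have hSU0 := hsum_S g0 (m + 1) S U
  have hSS0 := hsum_S (shf g0) (m + 1) S U
  have key : ∀ k, g1 k + shf g1 k = A * g2 k + B * (g1 k - shf g1 k) +
      C * (g0 k - 2 * shf g0 k + shf (shf g0) k) := by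
    have m0 : (0 : ℝ) ≤ m := by positivity
    have hA' : A = 2 * ((m : ℝ) + 2) * (m + 2 + α + β) / ((2 * m + 3 + α + β) * (2 * m + 4 + α + β)) := by
      rw [hA, jA, if_neg (by omega)]; push_cast; congr 1 <;> ring
    have hB' : B = (β ^ 2 - α ^ 2) / ((2 * m + 2 + α + β) * (2 * m + 4 + α + β)) := by
      rw [hB, jB, if_neg (by omega)]; push_cast; congr 1; ring
    have hC' : C = 2 * ((m : ℝ) + 1 + α) * (m + 1 + β) / ((2 * m + 2 + α + β) * (2 * m + 3 + α + β)) := by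
      rw [hC, jC]
    have n1 : (2 * (m : ℝ) + 2 + α + β) ≠ 0 := by linarith
    have n2 : (2 * (m : ℝ) + 2 + α + β) + 1 ≠ 0 := by linarith
    have n3 : (2 * (m : ℝ) + 2 + α + β) + 2 ≠ 0 := by linarith
    rw [show 2 * (m : ℝ) + 3 + α + β = 2 * (m : ℝ) + 2 + α + β + 1 by ring,
      show 2 * (m : ℝ) + 4 + α + β = 2 * (m : ℝ) + 2 + α + β + 2 by ring] at hA'
    rw [show 2 * (m : ℝ) + 4 + α + β = 2 * (m : ℝ) + 2 + α + β + 2 by ring] at hB'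
    rw [show 2 * (m : ℝ) + 3 + α + β = 2 * (m : ℝ) + 2 + α + β + 1 by ring] at hC'
    obtain ⟨D, hD⟩ : ∃ D, D = 2 * (m : ℝ) + 2 + α + β := ⟨_, rfl⟩
    have eβ : β = D - 2 * m - 2 - α := by linarith
    rw [← hD] at n1 n2 n3 hA' hB' hC'
    have n4 : (m : ℝ) + 1 ≠ 0 := by linarith
    have n5 : (m : ℝ) + 2 ≠ 0 := by linarith
    intro k
    match k with
    | 0 =>
      simp only [shf]
      have a1 : g1 0 = g0 0 * ((m : ℝ) + 1 + α) / (m + 1) := by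
        rw [eq_div_iff n4]; exact jco_R3 hα hβ m
      have a2 : g2 0 = g1 0 * ((m : ℝ) + 2 + α) / (m + 2) := by
        rw [eq_div_iff n5]; have := jco_R3 hα hβ (m + 1); push_cast at this
        rw [show (m : ℝ) + 2 = m + 1 + 1 by ring]; exact this
      rw [a2, a1, hA', hB', hC']
      clear_value A B C g0 g1 g2 S U
      clear hD hA' hB' hC'
      subst eβ
      field_simp
      ring
    | 1 =>
      simp only [shf]
      have nα : α + 1 ≠ 0 := by linarith
      have a1 : g1 0 = g0 0 * ((m : ℝ) + 1 + α) / (m + 1) := by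
        rw [eq_div_iff n4]; exact jco_R3 hα hβ m
      have a2 : g2 1 = g1 0 * (((m : ℝ) + 2 + α) * (m + 2 + β)) / (α + 1) := by
        rw [eq_div_iff nα]; have := jco_R2 hα hβ (m + 1) 0; push_cast at this
        simp only [zero_add, one_mul, add_zero] at this
        rw [hg2, this]; ring
      have a3 : g1 1 = g0 0 * (((m : ℝ) + 1 + α) * (m + 1 + β)) / (α + 1) := by
        rw [eq_div_iff nα]; have := jco_R2 hα hβ m 0; push_cast at this
        simp only [zero_add, one_mul, add_zero] at this
        rw [hg1, this]
      have a4 : g0 1 = g0 0 * ((m : ℝ) * (m + β)) / (α + 1) := by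
        rw [eq_div_iff nα]; have := jco_R1 hα hβ m 0; push_cast at this
        simp only [zero_add, one_mul, add_zero, sub_zero] at this
        rw [hg0, this]
      rw [a2, a3, a4, a1, hA', hB', hC']
      clear_value A B C g0 g1 g2 S U
      clear hD hA' hB' hC'
      subst eβ
      field_simp
      ring
    | k + 2 =>
      simp only [shf]
      have k0 : (0 : ℝ) ≤ k := by positivity
      have k1 : (k : ℝ) + 1 ≠ 0 := by linarith
      have k2 : (k : ℝ) + 2 ≠ 0 := by linarith
      have k3 : α + k + 1 ≠ 0 := by linarith
      have k4 : α + k + 2 ≠ 0 := by linarith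
      have a1 : g0 (k + 1) = g0 k * (((m : ℝ) - k) * (m + β - k)) / (((k : ℝ) + 1) * (α + k + 1)) := by
        rw [eq_div_iff (mul_ne_zero k1 k3)]; exact jco_R1 hα hβ m k
      have a2 : g0 (k + 2) = g0 (k + 1) * (((m : ℝ) - k - 1) * (m + β - k - 1)) / (((k : ℝ) + 2) * (α + k + 2)) := by
        rw [eq_div_iff (mul_ne_zero k2 k4)]; have := jco_R1 hα hβ m (k + 1); push_cast at this
        rw [hg0]; linear_combination this
      have a3 : g1 (k + 1) = g0 k * (((m : ℝ) + 1 + α) * (m + 1 + β)) / (((k : ℝ) + 1) * (α + k + 1)) := by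
        rw [eq_div_iff (mul_ne_zero k1 k3)]; exact jco_R2 hα hβ m k
      have a4 : g1 (k + 2) = g1 (k + 1) * (((m : ℝ) - k) * (m + β - k)) / (((k : ℝ) + 2) * (α + k + 2)) := by
        rw [eq_div_iff (mul_ne_zero k2 k4)]; have := jco_R1 hα hβ (m + 1) (k + 1); push_cast at this
        rw [hg1]; linear_combination this
      have a5 : g2 (k + 2) = g1 (k + 1) * (((m : ℝ) + 2 + α) * (m + 2 + β)) / (((k : ℝ) + 2) * (α + k + 2)) := by
        rw [eq_div_iff (mul_ne_zero k2 k4)]; have := jco_R2 hα hβ (m + 1) (k + 1); push_cast at this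
        rw [hg2]; linear_combination this
      rw [a5, a4, a3, a2, a1, hA', hB', hC']
      clear_value A B C g0 g1 g2 S U
      clear hD hA' hB' hC'
      subst eβ
      field_simp
      ring
  have hfun : hsum (fun k => g1 k + shf g1 k) (m + 2) S U = hsum (fun k => A * g2 k + B * (g1 k - shf g1 k) +
      C * (g0 k - 2 * shf g0 k + shf (shf g0) k)) (m + 2) S U := by
    congr 1; funext k; exact key k
  have hexp : hsum (fun k => A * g2 k + B * (g1 k - shf g1 k) +
      C * (g0 k - 2 * shf g0 k + shf (shf g0) k)) (m + 2) S U =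
      A * hsum g2 (m + 2) S U + B * (hsum g1 (m + 2) S U - hsum (shf g1) (m + 2) S U) +
      C * (hsum g0 (m + 2) S U - 2 * hsum (shf g0) (m + 2) S U + hsum (shf (shf g0)) (m + 2) S U) := by
    unfold hsum
    simp only [Finset.mul_sum, ← Finset.sum_add_distrib, ← Finset.sum_sub_distrib]
    exact Finset.sum_congr rfl fun k _ => by ring
  rw [← hsum_add, hexp, ← hU1, ← hS1, ← hUU0, ← hSU0, ← hSS0, ← hS0, ← hU0] at hfun
  have e2 : U = 1 + S := by linarith
  rw [ex]
  rw [e2] at hfun ⊢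
  linear_combination hfun

end jac
end part8

section part9
section orth
variable {α β : ℝ}

def jw (α β θ : ℝ) : ℝ := (Real.sin (θ/2)) ^ (2*α+1) * (Real.cos (θ/2)) ^ (2*β+1)

lemma jw_meas : Measurable (fun θ => ENNReal.ofReal (jw α β θ)) := by
  unfold jw
  have h1 : Measurable fun θ : ℝ => Real.sin (θ / 2) := by fun_prop
  have h2 : Measurable fun θ : ℝ => Real.cos (θ / 2) := by fun_prop
  exact ((h1.pow_const _).mul (h2.pow_const _)).ennreal_ofReal

lemma sc_pos {θ : ℝ} (h : θ ∈ Ioo 0 π) : 0 < Real.sin (θ / 2) ∧ 0 < Real.cos (θ / 2) := by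
  obtain ⟨h1, h2⟩ := h
  exact ⟨Real.sin_pos_of_pos_of_lt_pi (by linarith) (by linarith),
    Real.cos_pos_of_mem_Ioo ⟨by linarith, by linarith⟩⟩

lemma jw_nonneg {θ : ℝ} (h : θ ∈ Ioo 0 π) : 0 ≤ jw α β θ := by
  obtain ⟨h1, h2⟩ := sc_pos h
  unfold jw; positivity

lemma jmeas_integral (f : ℝ → ℝ) : ∫ θ, f θ ∂(jacobiMeasure α β) = ∫ θ in Ioo 0 π, jw α β θ * f θ := by
  unfold jacobiMeasure
  change ∫ θ, f θ ∂((volume.restrict (Set.Ioo 0 π)).withDensity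
    (fun θ => ENNReal.ofReal (jw α β θ))) = _
  rw [integral_withDensity_eq_integral_toReal_smul jw_meas (by simp)]
  refine setIntegral_congr_fun measurableSet_Ioo fun θ hθ => ?_
  simp [ENNReal.toReal_ofReal (jw_nonneg hθ)]

lemma jmeas_integrable {f : ℝ → ℝ} (h : Integrable f (jacobiMeasure α β)) :
    IntegrableOn (fun θ => jw α β θ * f θ) (Ioo 0 π) := by
  unfold jacobiMeasure at h
  change Integrable f ((volume.restrict (Set.Ioo 0 π)).withDensity
    (fun θ => ENNReal.ofReal (jw α β θ))) at h
  rw [integrable_withDensity_iff_integrable_smul' jw_meas (by simp)] at h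
  refine IntegrableOn.congr_fun h (fun θ hθ => ?_) measurableSet_Ioo
  simp [ENNReal.toReal_ofReal (jw_nonneg hθ)]

lemma jacobi_cont (n : ℕ) : Continuous (jacobiPoly α β n) := by
  unfold jacobiPoly; fun_prop

lemma jmeas_finite (hα : -1 < α) (hβ : -1 < β) {c : ℕ → ℝ} (hc : JacobiNormalized α β c) :
    IsFiniteMeasure (jacobiMeasure α β) := by
  have h := hc.2 0
  have h0 : ∀ θ, (nJacobi α β c 0 θ)^2 = (c 0)^2 := by
    intro θ; simp [nJacobi, jacobi_zero hα hβ]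
  simp only [h0, integral_const] at h
  by_contra hn
  rw [isFiniteMeasure_iff, not_lt, top_le_iff] at hn
  simp [Measure.real, hn] at h

lemma jint (hα : -1 < α) (hβ : -1 < β) {c : ℕ → ℝ} (hc : JacobiNormalized α β c) {p : ℝ → ℝ}
    (hp : Continuous p) : Integrable (fun θ => p (Real.cos θ)) (jacobiMeasure α β) := by
  have := jmeas_finite hα hβ hc
  obtain ⟨C, hC⟩ := (isCompact_Icc (a := (-1 : ℝ)) (b := 1)).exists_bound_of_continuousOn hp.continuousOn
  refine Integrable.of_bound (hp.comp Real.continuous_cos).aestronglyMeasurable C ?_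
  exact Eventually.of_forall fun θ => hC _ ⟨Real.neg_one_le_cos θ, Real.cos_le_one θ⟩

lemma rpow_deriv_term (a b k l : ℝ) (p q : ℕ) (hk : k = p) (hl : l = q) {θ : ℝ} (h : θ ∈ Ioo 0 π) :
    HasDerivAt (fun θ : ℝ => Real.sin (θ/2) ^ (2 * a + 2 + 2 * k) * Real.cos (θ/2) ^ (2 * b + 2 + 2 * l))
      (jw a b θ * ((a + 1 + k) * (Real.sin (θ/2) ^ 2) ^ p * (Real.cos (θ/2) ^ 2) ^ (q + 1)
        - (b + 1 + l) * (Real.sin (θ/2) ^ 2) ^ (p + 1) * (Real.cos (θ/2) ^ 2) ^ q)) θ := by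
  obtain ⟨h1, h2⟩ := sc_pos h
  have d : HasDerivAt (fun θ : ℝ => θ / 2) (1 / 2) θ := (hasDerivAt_id θ).div_const 2
  have ds := (d.sin).rpow_const (p := 2 * a + 2 + 2 * k) (Or.inl h1.ne')
  have dc := (d.cos).rpow_const (p := 2 * b + 2 + 2 * l) (Or.inl h2.ne')
  refine (ds.mul dc).congr_deriv ?_
  unfold jw
  set s := Real.sin (θ / 2)
  set c := Real.cos (θ / 2)
  have e1 : s ^ (2 * a + 2 + 2 * k - 1) = s ^ (2 * a + 1) * (s ^ 2) ^ p := by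
    rw [← pow_mul, ← Real.rpow_natCast, ← Real.rpow_add h1]; congr 1; push_cast; rw [hk]; ring
  have e2 : s ^ (2 * a + 2 + 2 * k) = s ^ (2 * a + 1) * (s ^ 2) ^ p * s := by
    rw [← pow_mul, mul_assoc, ← pow_succ, ← Real.rpow_natCast, ← Real.rpow_add h1]; congr 1; push_cast; rw [hk]; ring
  have e3 : c ^ (2 * b + 2 + 2 * l - 1) = c ^ (2 * b + 1) * (c ^ 2) ^ q := by
    rw [← pow_mul, ← Real.rpow_natCast, ← Real.rpow_add h2]; congr 1; push_cast; rw [hl]; ring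
  have e4 : c ^ (2 * b + 2 + 2 * l) = c ^ (2 * b + 1) * (c ^ 2) ^ q * c := by
    rw [← pow_mul, mul_assoc, ← pow_succ, ← Real.rpow_natCast, ← Real.rpow_add h2]; congr 1; push_cast; rw [hl]; ring
  rw [e1, e2, e3, e4]
  ring

lemma jacobi_sum_id (hα : -1 < α) (hβ : -1 < β) (n : ℕ) (S U : ℝ) :
    ∑ k ∈ Finset.range n, (((n : ℝ) - k) * jco α β n k / (α + 1 + k)) *
      ((α + 1 + k) * S ^ k * U ^ (n - 1 - k + 1) + (β + 1 + (n - 1 - k)) * S ^ (k + 1) * U ^ (n - 1 - k))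
      = n * hsum (jco α β n) n S U := by
  have e : ∀ k ∈ Finset.range n, (((n : ℝ) - k) * jco α β n k / (α + 1 + k)) *
      ((α + 1 + k) * S ^ k * U ^ (n - 1 - k + 1) + (β + 1 + (n - 1 - k)) * S ^ (k + 1) * U ^ (n - 1 - k))
      = ((n : ℝ) - k) * (jco α β n k * S ^ k * U ^ (n - k)) +
        ((k : ℝ) + 1) * (jco α β n (k + 1) * S ^ (k + 1) * U ^ (n - (k + 1))) := by
    intro k hk
    have hk' := Finset.mem_range.mp hk
    have k0 : (0 : ℝ) ≤ k := by positivity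
    have h1 : α + 1 + k ≠ 0 := by linarith
    have r1 := jco_R1 hα hβ n k
    rw [show n - 1 - k + 1 = n - k by omega, show n - 1 - k = n - (k + 1) by omega]
    have r1' : ((k : ℝ) + 1) * jco α β n (k + 1) = ((n : ℝ) - k) * jco α β n k / (α + 1 + k) * (β + 1 + (n - 1 - k)) := by
      field_simp; linear_combination r1
    have : ((n : ℝ) - k) * jco α β n k = ((n : ℝ) - k) * jco α β n k / (α + 1 + k) * (α + 1 + k) := by
      field_simp
    linear_combination (-(S ^ (k+1) * U ^ (n - (k+1)))) * r1' - (S ^ k * U ^ (n - k)) * this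
  rw [Finset.sum_congr rfl e, Finset.sum_add_distrib]
  have h1 : ∑ k ∈ Finset.range n, ((n : ℝ) - k) * (jco α β n k * S ^ k * U ^ (n - k)) =
      ∑ k ∈ Finset.range (n + 1), ((n : ℝ) - k) * (jco α β n k * S ^ k * U ^ (n - k)) := by
    rw [Finset.sum_range_succ]; simp
  have h2 : ∑ k ∈ Finset.range n, ((k : ℝ) + 1) * (jco α β n (k + 1) * S ^ (k + 1) * U ^ (n - (k + 1))) =
      ∑ k ∈ Finset.range (n + 1), (k : ℝ) * (jco α β n k * S ^ k * U ^ (n - k)) := by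
    rw [Finset.sum_range_succ']; simp
  rw [h1, h2, ← Finset.sum_add_distrib, hsum, Finset.mul_sum]
  exact Finset.sum_congr rfl fun k _ => by ring

lemma jacobi_mean_zero (hα : -1 < α) (hβ : -1 < β) {c : ℕ → ℝ} (hc : JacobiNormalized α β c) (n : ℕ)
    (hn : 1 ≤ n) : ∫ θ, jacobiPoly α β n (Real.cos θ) ∂(jacobiMeasure α β) = 0 := by
  have n0 : (n : ℝ) ≠ 0 := by positivity
  set Φ : ℝ → ℝ := fun θ => ∑ k ∈ Finset.range n, (((n : ℝ) - k) * jco α β n k / (α + 1 + k)) *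
    ((-1) ^ k * (Real.sin (θ/2) ^ (2 * α + 2 + 2 * (k : ℝ)) *
      Real.cos (θ/2) ^ (2 * β + 2 + 2 * ((n : ℝ) - 1 - k)))) with hΦ
  have hd : ∀ θ ∈ Ioo 0 π, HasDerivAt Φ (jw α β θ * (n * jacobiPoly α β n (Real.cos θ))) θ := by
    intro θ hθ
    have h1 := HasDerivAt.fun_sum (u := Finset.range n) (x := θ) (A := fun k θ => (((n : ℝ) - k) * jco α β n k / (α + 1 + k)) *
      ((-1) ^ k * (Real.sin (θ/2) ^ (2 * α + 2 + 2 * (k : ℝ)) *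
      Real.cos (θ/2) ^ (2 * β + 2 + 2 * ((n : ℝ) - 1 - k))))) fun k hk =>
        (((rpow_deriv_term α β k ((n : ℝ) - 1 - k) k (n - 1 - k) rfl (by
          have := Finset.mem_range.mp hk
          rw [Nat.cast_sub (by omega), Nat.cast_sub (by omega)]; simp) hθ).const_mul ((-1) ^ k)).const_mul
            (((n : ℝ) - k) * jco α β n k / (α + 1 + k)))
    refine h1.congr_deriv ?_
    have es : -(Real.sin (θ / 2) ^ 2) = (Real.cos θ - 1) / 2 := by
      rw [Real.sin_sq, Real.cos_sq]; rw [show 2 * (θ / 2) = θ by ring]; ring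
    have ec : Real.cos (θ / 2) ^ 2 = (Real.cos θ + 1) / 2 := by
      rw [Real.cos_sq]; rw [show 2 * (θ / 2) = θ by ring]; ring
    rw [jacobiPoly_eq, ← jacobi_sum_id hα hβ, Finset.mul_sum, ← es, ← ec]
    refine Finset.sum_congr rfl fun k hk => ?_
    generalize Real.sin (θ / 2) ^ 2 = s
    generalize Real.cos (θ / 2) ^ 2 = u
    rw [neg_pow s k, neg_pow s (k + 1), pow_succ (-1 : ℝ)]
    ring
  have hcont : ContinuousOn Φ (Icc 0 π) := by
    refine continuousOn_finsetSum _ fun k hk => ?_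
    have hk' : (k : ℝ) + 1 ≤ n := by exact_mod_cast Finset.mem_range.mp hk
    have k0 : (0 : ℝ) ≤ k := by positivity
    refine Continuous.continuousOn ?_
    refine continuous_const.mul (continuous_const.mul (Continuous.mul ?_ ?_))
    · exact (Real.continuous_sin.comp (continuous_id.div_const 2)).rpow_const fun x => Or.inr (by linarith)
    · exact (Real.continuous_cos.comp (continuous_id.div_const 2)).rpow_const fun x => Or.inr (by linarith)
  have hIoo : IntegrableOn (fun θ => jw α β θ * (n * jacobiPoly α β n (Real.cos θ))) (Ioo 0 π) :=
    jmeas_integrable ((jint hα hβ hc (jacobi_cont n)).const_mul n)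
  have hIntv : IntervalIntegrable (fun θ => jw α β θ * (n * jacobiPoly α β n (Real.cos θ))) volume 0 π := by
    rw [intervalIntegrable_iff_integrableOn_Ioo_of_le Real.pi_pos.le]; exact hIoo
  have key := intervalIntegral.integral_eq_sub_of_hasDerivAt_of_le Real.pi_pos.le hcont hd hIntv
  have z0 : Φ 0 = 0 := by
    refine Finset.sum_eq_zero fun k hk => ?_
    have k0 : (0 : ℝ) ≤ k := by positivity
    rw [zero_div, Real.sin_zero, Real.zero_rpow (by linarith)]; ring
  have zπ : Φ π = 0 := by
    refine Finset.sum_eq_zero fun k hk => ?_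
    have hk' : (k : ℝ) + 1 ≤ n := by exact_mod_cast Finset.mem_range.mp hk
    rw [Real.cos_pi_div_two, Real.zero_rpow (by linarith)]; ring
  rw [z0, zπ, sub_zero, intervalIntegral.integral_of_le Real.pi_pos.le, integral_Ioc_eq_integral_Ioo,
    ← jmeas_integral, integral_const_mul] at key
  exact (mul_eq_zero.mp key).resolve_left n0

def jCt (α β : ℝ) : ℕ → ℝ
  | 0 => 0
  | m + 1 => jC α β m

lemma jacobi_rec' (hα : -1 < α) (hβ : -1 < β) (n : ℕ) (x : ℝ) :
    x * jacobiPoly α β n x = jA α β n * jacobiPoly α β (n + 1) x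
      + jB α β n * jacobiPoly α β n x + jCt α β n * jacobiPoly α β (n - 1) x := by
  cases n with
  | zero => simp [jCt, jacobi_rec0 hα hβ]
  | succ m => exact jacobi_rec hα hβ m x

lemma jA_pos (hα : -1 < α) (hβ : -1 < β) (n : ℕ) : 0 < jA α β n := by
  unfold jA
  split_ifs with h
  · have : 0 < α + β + 2 := by linarith
    positivity
  · have : (1 : ℝ) ≤ n := by exact_mod_cast Nat.one_le_iff_ne_zero.mpr h
    have h1 : 0 < n + α + β + 1 := by linarith
    have h2 : 0 < 2 * n + α + β + 1 := by linarith
    have h3 : 0 < 2 * n + α + β + 2 := by linarith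
    positivity

lemma jC_pos (hα : -1 < α) (hβ : -1 < β) (n : ℕ) : 0 < jC α β n := by
  unfold jC
  have : (0 : ℝ) ≤ n := by positivity
  have h1 : 0 < n + 1 + α := by linarith
  have h4 : 0 < n + 1 + β := by linarith
  have h2 : 0 < 2 * n + 2 + α + β := by linarith
  have h3 : 0 < 2 * n + 3 + α + β := by linarith
  positivity

def jE (α β : ℝ) (m n : ℕ) : ℝ :=
  ∫ θ, jacobiPoly α β m (Real.cos θ) * jacobiPoly α β n (Real.cos θ) ∂(jacobiMeasure α β)

lemma int_lin3 {ν : Measure ℝ} (a b c : ℝ) {f g h : ℝ → ℝ} (hf : Integrable f ν) (hg : Integrable g ν)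
    (hh : Integrable h ν) :
    a * (∫ x, f x ∂ν) + b * (∫ x, g x ∂ν) + c * (∫ x, h x ∂ν) = ∫ x, (a * f x + b * g x + c * h x) ∂ν := by
  have e1 : ∫ x, (a * f x + b * g x + c * h x) ∂ν = (∫ x, (a * f x + b * g x) ∂ν) + ∫ x, c * h x ∂ν :=
    integral_add ((hf.const_mul a).add (hg.const_mul b)) (hh.const_mul c)
  have e2 : ∫ x, (a * f x + b * g x) ∂ν = (∫ x, a * f x ∂ν) + ∫ x, b * g x ∂ν :=
    integral_add (hf.const_mul a) (hg.const_mul b)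
  rw [e1, e2, integral_const_mul, integral_const_mul, integral_const_mul]

lemma jE_rec (hα : -1 < α) (hβ : -1 < β) {c : ℕ → ℝ} (hc : JacobiNormalized α β c) (m n : ℕ) :
    jA α β m * jE α β (m + 1) n + jB α β m * jE α β m n + jCt α β m * jE α β (m - 1) n =
    jA α β n * jE α β m (n + 1) + jB α β n * jE α β m n + jCt α β n * jE α β m (n - 1) := by
  have hi : ∀ p q, Integrable (fun θ => jacobiPoly α β p (Real.cos θ) * jacobiPoly α β q (Real.cos θ))
      (jacobiMeasure α β) := fun p q =>
    jint hα hβ hc (p := fun x => jacobiPoly α β p x * jacobiPoly α β q x) ((jacobi_cont p).mul (jacobi_cont q))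
  unfold jE
  rw [int_lin3 _ _ _ (hi _ _) (hi _ _) (hi _ _), int_lin3 _ _ _ (hi _ _) (hi _ _) (hi _ _)]
  congr 1
  funext θ
  have e1 := jacobi_rec' hα hβ m (Real.cos θ)
  have e2 := jacobi_rec' hα hβ n (Real.cos θ)
  linear_combination (-jacobiPoly α β n (Real.cos θ)) * e1 + (jacobiPoly α β m (Real.cos θ)) * e2

lemma jE_orth (hα : -1 < α) (hβ : -1 < β) {c : ℕ → ℝ} (hc : JacobiNormalized α β c) (m : ℕ) :
    ∀ n, m < n → jE α β m n = 0 := by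
  induction m using Nat.strong_induction_on with
  | _ m ih =>
    intro n hn
    cases m with
    | zero =>
      unfold jE
      simp only [jacobi_zero hα hβ, one_mul]
      exact jacobi_mean_zero hα hβ hc n hn
    | succ m =>
      have h := jE_rec hα hβ hc m n
      rw [ih m (by omega) n (by omega), ih m (by omega) (n + 1) (by omega),
        ih m (by omega) (n - 1) (by omega)] at h
      have h3 : jCt α β m * jE α β (m - 1) n = 0 := by
        cases m with
        | zero => simp [jCt]
        | succ m => rw [ih _ (by omega) n (by omega), mul_zero]
      rw [h3] at h
      simp only [mul_zero, add_zero] at h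
      exact (mul_eq_zero.mp h).resolve_left (jA_pos hα hβ m).ne'

lemma jE_diag (hα : -1 < α) (hβ : -1 < β) {c : ℕ → ℝ} (hc : JacobiNormalized α β c) (m : ℕ) :
    jA α β m * jE α β (m + 1) (m + 1) = jC α β m * jE α β m m := by
  have h := jE_rec hα hβ hc m (m + 1)
  rw [jE_orth hα hβ hc m (m + 1) (by omega), jE_orth hα hβ hc m (m + 1 + 1) (by omega)] at h
  have h3 : jCt α β m * jE α β (m - 1) (m + 1) = 0 := by
    cases m with
    | zero => simp [jCt]
    | succ m => rw [jE_orth hα hβ hc _ _ (by omega), mul_zero]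
  rw [h3] at h
  simpa [jCt] using h

lemma jE_norm {c : ℕ → ℝ} (hc : JacobiNormalized α β c) (m : ℕ) : c m ^ 2 * jE α β m m = 1 := by
  rw [← hc.2 m, jE, ← integral_const_mul]
  congr 1; funext θ; unfold nJacobi; ring

lemma c_rec (hα : -1 < α) (hβ : -1 < β) {c : ℕ → ℝ} (hc : JacobiNormalized α β c) (m : ℕ) :
    jA α β m * c m ^ 2 = jC α β m * c (m + 1) ^ 2 := by
  have h1 := jE_norm hc m
  have h2 := jE_norm hc (m + 1)
  have h := jE_diag hα hβ hc m
  linear_combination (-(jA α β m * c m ^ 2)) * h2 + (jC α β m * c (m + 1) ^ 2) * h1 + (c m ^ 2 * c (m + 1) ^ 2) * h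

end orth
end part9

section part10
section build
variable {α β : ℝ}

def jg (α β : ℝ) : ℕ → ℝ
  | 0 => 1
  | n + 1 => jg α β n / (2 * jA α β n)

lemma jg_pos (hα : -1 < α) (hβ : -1 < β) (n : ℕ) : 0 < jg α β n := by
  induction n with
  | zero => exact one_pos
  | succ n ih => have := jA_pos hα hβ n; unfold jg; positivity

def ju (α β : ℝ) (n : ℤ) (θ : ℝ) : ℝ := if 0 ≤ n then jacobiPoly α β n.toNat (Real.cos θ) / jg α β n.toNat else 0
def jb (α β : ℝ) (n : ℤ) : ℝ := if 0 ≤ n then 2 * jB α β n.toNat else 0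
def jgam (α β : ℝ) (n : ℤ) : ℝ := if 1 ≤ n then 4 * jA α β (n - 1).toNat * jC α β (n - 1).toNat else 0
def jW (α β : ℝ) (c : ℕ → ℝ) (n : ℤ) : ℝ := if 0 ≤ n then c n.toNat ^ 2 * jg α β n.toNat ^ 2 else 0

lemma ju_nat (n : ℕ) (θ : ℝ) : ju α β n θ = jacobiPoly α β n (Real.cos θ) / jg α β n := by
  simp [ju]

lemma jb_symb (hα : -1 < α) (hβ : -1 < β) : Symb (-2) (fun (_ : Unit) n => jb α β n) := by
  set d := (α + β) / 2 with hd
  have hd1 : -1 < d := by rw [hd]; linarith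
  have s1 := symb_inv (ι := Unit) d 1 (by norm_num) (by push_cast; linarith)
  have s2 := symb_inv (ι := Unit) (d + 1) 1 (by norm_num) (by push_cast; linarith)
  have s3 := ((s1.mul s2).const_mul ((β ^ 2 - α ^ 2) / 2)).mono (show (-1 + -1 : ℤ) ≤ -2 by norm_num)
  have s4 := symb_single (ι := Unit) (fun _ => jb α β 0) |jb α β 0| (fun _ => le_rfl) 0 (-2)
  convert s3.add s4 using 3 with i n
  rcases lt_trichotomy n 0 with h | h | h
  · rw [jb, if_neg (by omega), if_neg (by omega), if_neg (by omega), if_neg (by omega)]; ring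
  · subst h; simp
  · rw [if_pos (by omega), if_pos (by omega), if_neg (by omega), jb, if_pos (by omega)]
    obtain ⟨m, rfl⟩ : ∃ m : ℕ, n = m := ⟨n.toNat, by omega⟩
    have h1 : (1 : ℝ) ≤ m := by exact_mod_cast (show 1 ≤ m by omega)
    rw [Int.toNat_natCast, jB, if_neg (by omega)]
    rw [show 2 * (m : ℝ) + α + β = 2 * (m + d) by rw [hd]; ring]
    push_cast
    have p1 : (m : ℝ) + d ≠ 0 := by linarith
    have p2 : (m : ℝ) + d + 1 ≠ 0 := by linarith
    rw [← add_assoc (m : ℝ) d 1]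
    generalize (m : ℝ) + d = x at *
    rw [show 2 * x + 2 = 2 * (x + 1) by ring]
    field_simp
    ring

lemma jgam_symb (hα : -1 < α) (hβ : -1 < β) :
    Symb (-2) (fun (_ : Unit) n => jgam α β n - if 1 ≤ n then 1 else 0) := by
  set d := (α + β) / 2 with hd
  have hd1 : -1 < d := by rw [hd]; linarith
  have s1 := symb_inv (ι := Unit) (d - 1 / 2) 2 (by norm_num) (by push_cast; linarith)
  have s2 := symb_inv (ι := Unit) (d + 1 / 2) 2 (by norm_num) (by push_cast; linarith)
  have s0 := symb_inv (ι := Unit) d 2 (by norm_num) (by push_cast; linarith)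
  have s3 := ((s0.mul s0).const_mul (d ^ 2 * (d ^ 2 - α * β))).mono (show (-1 + -1 : ℤ) ≤ 0 by norm_num)
  have s4 := (symb_const (ι := Unit) (α * β - 2 * d ^ 2 + 1 / 4)).add s3
  have s5 := ((s1.mul s2).mul s4).mono (show (-1 + -1 + 0 : ℤ) ≤ -2 by norm_num)
  have s6 := symb_single (ι := Unit) (fun _ => jgam α β 1 - 1) |jgam α β 1 - 1| (fun _ => le_rfl) 1 (-2)
  convert s5.add s6 using 3 with i n
  rcases lt_trichotomy n 1 with h | h | h
  · have h1 : ¬ (1 : ℤ) ≤ n := by omega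
    have h2 : ¬ (2 : ℤ) ≤ n := by omega
    have h3 : ¬ n = 1 := by omega
    simp [jgam, h1, h2, h3]
  · subst h; simp
  · rw [if_pos (by omega), if_pos (by omega), if_pos (by omega), if_pos (by omega), if_neg (by omega), jgam,
      if_pos (by omega)]
    obtain ⟨m, rfl⟩ : ∃ m : ℕ, n = (m + 1 : ℕ) := ⟨(n - 1).toNat, by omega⟩
    have h1 : (1 : ℝ) ≤ m := by exact_mod_cast (show 1 ≤ m by omega)
    rw [show (((m + 1 : ℕ) : ℤ) - 1).toNat = m by omega, jA, if_neg (by omega), jC]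
    push_cast
    have p1 : (m : ℝ) + 1 + d ≠ 0 := by linarith
    have p2 : (m : ℝ) + 1 + d + 1 / 2 ≠ 0 := by linarith
    have p3 : (m : ℝ) + 1 + d - 1 / 2 ≠ 0 := by linarith
    rw [show 2 * (m : ℝ) + α + β + 1 = 2 * (m + 1 + d - 1 / 2) by rw [hd]; ring,
      show 2 * (m : ℝ) + α + β + 2 = 2 * (m + 1 + d) by rw [hd]; ring,
      show 2 * (m : ℝ) + 2 + α + β = 2 * (m + 1 + d) by rw [hd]; ring,
      show 2 * (m : ℝ) + 3 + α + β = 2 * (m + 1 + d + 1 / 2) by rw [hd]; ring,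
      show (m : ℝ) + 1 + (d - 1 / 2) = m + 1 + d - 1 / 2 by ring,
      show (m : ℝ) + 1 + (d + 1 / 2) = m + 1 + d + 1 / 2 by ring]
    have e1 : ((m : ℝ) + 1) * (m + α + β + 1) = (m + 1 + d) ^ 2 - d ^ 2 := by rw [hd]; ring
    have e2 : ((m : ℝ) + 1 + α) * (m + 1 + β) = (m + 1 + d) ^ 2 - d ^ 2 + α * β := by rw [hd]; ring
    rw [mul_assoc 2 ((m : ℝ) + 1) _, mul_assoc 2 ((m : ℝ) + 1 + α) _, e1, e2]
    clear_value d
    clear e1 e2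
    generalize (m : ℝ) + 1 + d = x at *
    obtain ⟨y, hy⟩ : ∃ y, y = x - 1 / 2 := ⟨_, rfl⟩
    obtain ⟨z, hz⟩ : ∃ z, z = x + 1 / 2 := ⟨_, rfl⟩
    rw [← hy] at p3 ⊢
    rw [← hz] at p2 ⊢
    generalize α * β = k
    have hyz : y * z = x ^ 2 - 1 / 4 := by rw [hy, hz]; ring
    field_simp
    linear_combination (-16 * x ^ 2) * hyz

lemma jacobi_JSys (hα : -1 < α) (hβ : -1 < β) {c : ℕ → ℝ} (hc : JacobiNormalized α β c) :
    JSys (ju α β) (jb α β) (jgam α β) (jW α β c) where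
  smooth n := by
    unfold ju
    split_ifs
    · unfold jacobiPoly
      fun_prop
    · exact contDiff_const
  uneg n hn θ := by rw [ju, if_neg (by omega)]
  uzero θ := by simp [ju, jacobi_zero hα hβ, jg]
  hrec n hn θ := by
    obtain ⟨m, rfl⟩ : ∃ m : ℕ, n = m := ⟨n.toNat, by omega⟩
    have hA := jA_pos hα hβ m
    have hg := jg_pos hα hβ m
    have hr := jacobi_rec' hα hβ m (Real.cos θ)
    have e1 : ju α β ((m : ℤ) + 1) θ = 2 * jA α β m * jacobiPoly α β (m + 1) (Real.cos θ) / jg α β m := by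
      have := ju_nat (α := α) (β := β) (m + 1) θ
      push_cast at this
      rw [this, jg]; field_simp
    have e2 : jgam α β m * ju α β ((m : ℤ) - 1) θ = 2 * jCt α β m * jacobiPoly α β (m - 1) (Real.cos θ) / jg α β m := by
      cases m with
      | zero => simp [jgam, jCt]
      | succ k =>
        have hA := jA_pos hα hβ k
        have hg := jg_pos hα hβ k
        rw [jgam, if_pos (by push_cast; omega)]
        push_cast
        rw [show (k : ℤ) + 1 - 1 = k by ring, ju_nat, Int.toNat_natCast, jCt, jg]
        field_simp
        ring
    rw [e1, e2, ju_nat, jb, if_pos (by omega), Int.toNat_natCast]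
    field_simp
    linear_combination hr
  hb := jb_symb hα hβ
  hγ := jgam_symb hα hβ
  bneg n hn := by rw [jb, if_neg (by omega)]
  γneg n hn := by rw [jgam, if_neg (by omega)]
  γpos n hn := by
    rw [jgam, if_pos hn]
    have := jA_pos hα hβ (n - 1).toNat
    have := jC_pos hα hβ (n - 1).toNat
    positivity
  Wneg n hn := by rw [jW, if_neg (by omega)]
  Wrec n hn := by
    obtain ⟨m, rfl⟩ : ∃ m : ℕ, n = m := ⟨n.toNat, by omega⟩
    rw [jgam, if_pos (by omega), jW, if_pos (by omega), jW, if_pos (by omega)]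
    rw [show (m : ℤ) + 1 - 1 = m by ring, Int.toNat_natCast, show ((m : ℤ) + 1).toNat = m + 1 by omega, jg]
    have hA := jA_pos hα hβ m
    have := c_rec hα hβ hc m
    field_simp
    linear_combination (-4 * jg α β m ^ 2) * this
  W0 := by rw [jW, if_pos le_rfl]; positivity

lemma tilde_term (hα : -1 < α) (hβ : -1 < β) (c : ℕ → ℝ) (t θ φ : ℝ) (n : ℕ) :
    exp (-t * |((n + 1 : ℕ) : ℝ) + jacobiTau α β|) * nJacobi α β c (n + 1) θ * nJacobi α β c (n + 1) φ
      = exp (-t * ((n : ℝ) + 1 + jacobiTau α β)) * ju α β (n + 1) θ * (jW α β c (n + 1) * ju α β (n + 1) φ) := by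
  have hτ : -1 < jacobiTau α β := by unfold jacobiTau; linarith
  have n0 : (0 : ℝ) ≤ n := by positivity
  have hg := jg_pos hα hβ (n + 1)
  have e1 : ∀ θ, ju α β ((n : ℤ) + 1) θ = jacobiPoly α β (n + 1) (Real.cos θ) / jg α β (n + 1) := by
    intro θ
    have := ju_nat (α := α) (β := β) (n + 1) θ
    push_cast at this
    exact this
  have e2 : jW α β c ((n : ℤ) + 1) = c (n + 1) ^ 2 * jg α β (n + 1) ^ 2 := by
    rw [jW, if_pos (by omega), show ((n : ℤ) + 1).toNat = n + 1 by omega]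
  rw [e1, e1, e2, Nat.cast_add, Nat.cast_one, abs_of_pos (by linarith)]
  unfold nJacobi
  generalize jg α β (n + 1) = g at *
  generalize jacobiPoly α β (n + 1) (Real.cos θ) = p1
  generalize jacobiPoly α β (n + 1) (Real.cos φ) = p2
  field_simp

lemma tilde_eq (hα : -1 < α) (hβ : -1 < β) {c : ℕ → ℝ} (hc : JacobiNormalized α β c) {t : ℝ} (ht : 0 < t)
    (θ φ : ℝ) : tildePoissonKer α β c t θ φ = absKer (ju α β) (jW α β c) (jacobiTau α β) t φ θ := by
  have hτ : -1 < jacobiTau α β := by unfold jacobiTau; linarith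
  have hJ := jacobi_JSys hα hβ hc
  set F : ℕ → ℝ := fun n => exp (-t * |(n : ℝ) + jacobiTau α β|) * nJacobi α β c n θ * nJacobi α β c n φ with hF
  have hterm : ∀ n : ℕ, F (n + 1) = exp (-t * ((n : ℝ) + 1 + jacobiTau α β)) * ju α β (n + 1) θ *
      (jW α β c (n + 1) * ju α β (n + 1) φ) := fun n => tilde_term hα hβ c t θ φ n
  have hs : Summable (fun n : ℕ => F (n + 1)) := by
    simp only [hterm]
    have := ((hJ.absKer_deriv _ hτ t ht φ 0).2 θ).1
    simpa only [iteratedDeriv_zero] using this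
  have h0 := Summable.tsum_eq_zero_add ((summable_nat_add_iff 1).mp hs)
  have h1 : poissonKer α β c t θ φ = ∑' n, F n := rfl
  have h2 : absKer (ju α β) (jW α β c) (jacobiTau α β) t φ θ = ∑' n : ℕ, F (n + 1) := by
    unfold absKer; exact tsum_congr fun n => (hterm n).symm
  have h3 : F 0 = Real.exp (-t * |jacobiTau α β|) * nJacobi α β c 0 θ * nJacobi α β c 0 φ := by
    simp only [hF, Nat.cast_zero, zero_add]
  unfold tildePoissonKer
  rw [h1, h0, h2, h3]
  ring

end build

theorem tilde_potential_kernel_derivative' (α β : ℝ) (hα : -1 < α) (hβ : -1 < β) (c : ℕ → ℝ)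
    (hc : JacobiNormalized α β c) (N : ℕ) (j : ℕ) (θ φ : ℝ)
    (hθ : θ ∈ Set.Ioo 0 π) (hφ : φ ∈ Set.Ioo 0 π) (hne : θ ≠ φ) :
    IntegrableOn (fun t => iteratedDeriv j (fun θ' => tildePoissonKer α β c t θ' φ) θ * t ^ (N-1))
      (Set.Ioi (0:ℝ)) volume ∧
    iteratedDeriv j (fun θ' => tildePotentialKer α β c N θ' φ) θ =
      (1 / Real.Gamma (N:ℝ)) *
        ∫ t in Set.Ioi (0:ℝ), iteratedDeriv j (fun θ' => tildePoissonKer α β c t θ' φ) θ * t ^ (N-1) := by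
  have hτ : -1 < jacobiTau α β := by unfold jacobiTau; linarith
  have hJ := jacobi_JSys hα hβ hc
  have hcos : Real.cos θ ≠ Real.cos φ := fun h => hne
    (Real.injOn_cos (Ioo_subset_Icc_self hθ) (Ioo_subset_Icc_self hφ) h)
  have e : ∀ t ∈ Ioi (0 : ℝ), (fun θ' => tildePoissonKer α β c t θ' φ) =
      absKer (ju α β) (jW α β c) (jacobiTau α β) t φ := fun t ht => funext fun θ' => tilde_eq hα hβ hc ht θ' φ
  constructor
  · refine IntegrableOn.congr_fun (hJ.integrable _ hτ φ θ hcos j (N - 1)) (fun t ht => ?_) measurableSet_Ioi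
    simp only [e t ht]
  · have h1 : ∫ t in Set.Ioi (0:ℝ), iteratedDeriv j (fun θ' => tildePoissonKer α β c t θ' φ) θ * t ^ (N-1) =
        ∫ t in Set.Ioi (0:ℝ), iteratedDeriv j (absKer (ju α β) (jW α β c) (jacobiTau α β) t φ) θ * t ^ (N-1) :=
      setIntegral_congr_fun measurableSet_Ioi fun t ht => by simp only [e t ht]
    have h2 : (fun θ' => tildePotentialKer α β c N θ' φ) = fun θ' => (1 / Real.Gamma (N:ℝ)) *
        ∫ t in Set.Ioi (0:ℝ), absKer (ju α β) (jW α β c) (jacobiTau α β) t φ θ' * t ^ (N-1) := by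
      funext θ'
      unfold tildePotentialKer
      congr 1
      exact setIntegral_congr_fun measurableSet_Ioi fun t ht => by simp only [tilde_eq hα hβ hc ht]
    rw [h1, h2, iteratedDeriv_const_mul_field, hJ.interchange _ hτ φ (N - 1) j θ hcos]

end part10

/-- differentiation in `θ` may be interchanged with the integral defining the
compensated potential kernel `K̃_{N/2}`: the integral converges absolutely and
`∂_θ^j K̃_{N/2}(θ,φ) = (1/Γ(N)) ∫₀^∞ ∂_θ^j H̃_t(θ,φ) t^{N−1} dt` for `θ ≠ φ`. -/
theorem tilde_potential_kernel_derivative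
    (α β : ℝ) (hα : -1 < α) (hβ : -1 < β)
    (c : ℕ → ℝ) (hc : JacobiNormalized α β c)
    (N : ℕ) (hN : 1 ≤ N) (j : ℕ)
    (θ φ : ℝ) (hθ : θ ∈ Set.Ioo 0 π) (hφ : φ ∈ Set.Ioo 0 π) (hne : θ ≠ φ) :
    IntegrableOn
      (fun t => iteratedDeriv j (fun θ' => tildePoissonKer α β c t θ' φ) θ * t ^ (N-1))
      (Set.Ioi 0) volume ∧
    iteratedDeriv j (fun θ' => tildePotentialKer α β c N θ' φ) θ =
      (1 / Real.Gamma (N:ℝ)) *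
        ∫ t in Set.Ioi (0:ℝ),
          iteratedDeriv j (fun θ' => tildePoissonKer α β c t θ' φ) θ * t ^ (N-1) := by
  exact tilde_potential_kernel_derivative' α β hα hβ c hc N j θ φ hθ hφ hne

end
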